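/- arXiv:2011.04162 — 5 statements merged into one kernel-verified Lean document; each statement's English description precedes it below -/
import Mathlib

section
/- Let F, S : ℝ^d → ℝ be three times continuously differentiable functions with S ≥ 0 and S(θ₀) = 0 (hence ∇S(θ₀) = 0 and H := ∇²S(θ₀) is positive semidefinite), and assume H is positive definite. Fix exponents c₁, c₂ with 1/3 < c₁ < 1/2 and 1 < c₂ < 3/2. For ε > 0 define m(ε) := inf { F(θ₀ + Δθ) : Δθ ∈ ℝ^d, ‖Δθ‖ ≤ ε^{c₁}, S(θ₀ + Δθ) ≤ ε + ε^{c₂} }. Then lim_{ε→0⁺} (m(ε) − F(θ₀))/√ε = −√(2 ⟨H⁻¹ ∇F(θ₀), ∇F(θ₀)⟩); moreover the infimum is asymptotically attained along Δθ_ε = −√(2ε) · H⁻¹∇F(θ₀)/√(⟨H⁻¹∇F(θ₀), ∇F(θ₀)⟩), which is feasible for all sufficiently small ε. -/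
open scoped RealInnerProductSpace

open Filter Asymptotics Topology

section Taylor

variable {E G : Type*} [NormedAddCommGroup E] [NormedSpace ℝ E]
  [NormedAddCommGroup G] [NormedSpace ℝ G]

/-- Integrating a pointwise bound on the derivative raises the order of vanishing at `0` by one. -/
theorem isBigO_norm_pow_succ_of_fderiv {g : E → G} {n : ℕ} (hg : Differentiable ℝ g)
    (hg0 : g 0 = 0) (h : fderiv ℝ g =O[𝓝 0] fun x => ‖x‖ ^ n) :
    g =O[𝓝 0] fun x => ‖x‖ ^ (n + 1) := by
  obtain ⟨C, hC, hb⟩ := h.exists_nonneg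
  obtain ⟨δ, hδ, hball⟩ := Metric.eventually_nhds_iff.1 hb.bound
  refine IsBigO.of_bound C (Metric.eventually_nhds_iff.2 ⟨δ, hδ, fun x hx => ?_⟩)
  have hbound : ∀ y ∈ Metric.closedBall (0 : E) ‖x‖, ‖fderiv ℝ g y‖ ≤ C * ‖x‖ ^ n := by
    intro y hy
    rw [mem_closedBall_zero_iff] at hy
    rw [dist_zero_right] at hx
    have hyb := hball (y := y) (by rw [dist_zero_right]; exact hy.trans_lt hx)
    rw [norm_pow, norm_norm] at hyb
    exact hyb.trans (by gcongr)
  have hmv := (convex_closedBall (0 : E) ‖x‖).norm_image_sub_le_of_norm_fderiv_le (𝕜 := ℝ)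
    (fun y _ => hg y) hbound (x := 0) (y := x) (by simp) (by simp)
  simpa [hg0, pow_succ, mul_assoc] using hmv

/-- The increment of a differentiable map, centred at `0`, is of first order. -/
theorem isBigO_sub_norm_pow_one {g : E → G} {x₀ : E} (hg : DifferentiableAt ℝ g x₀) :
    (fun x => g (x₀ + x) - g x₀) =O[𝓝 0] fun x => ‖x‖ ^ 1 := by
  have h := hg.hasFDerivAt.isBigO_sub.comp_tendsto (k := fun x : E => x₀ + x) (l' := 𝓝 0)
    (by simpa using (continuous_const_add x₀).tendsto (0 : E))
  simpa [Function.comp_def] using h.norm_right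

/-- First-order Taylor expansion with quadratic remainder. -/
theorem isBigO_taylor_one {f : E → G} (hf : ContDiff ℝ 2 f) (x₀ : E) :
    (fun x => f (x₀ + x) - f x₀ - fderiv ℝ f x₀ x) =O[𝓝 0] fun x => ‖x‖ ^ 2 := by
  have hd : Differentiable ℝ f := hf.differentiable (by norm_num)
  have hd' : Differentiable ℝ (fderiv ℝ f) :=
    (hf.fderiv_right (m := 1) (by norm_num)).differentiable (by norm_num)
  have hderiv (x : E) : HasFDerivAt (fun x => f (x₀ + x) - f x₀ - fderiv ℝ f x₀ x)
      (fderiv ℝ f (x₀ + x) - fderiv ℝ f x₀) x :=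
    (((hasFDerivAt_comp_add_left x₀).2 (hd (x₀ + x)).hasFDerivAt).sub_const _).sub
      (fderiv ℝ f x₀).hasFDerivAt
  refine isBigO_norm_pow_succ_of_fderiv (n := 1) (fun x => (hderiv x).differentiableAt)
    (by simp) ?_
  rw [funext fun x => (hderiv x).fderiv]
  exact isBigO_sub_norm_pow_one (hd' x₀)

/-- Second-order Taylor expansion with cubic remainder. -/
theorem isBigO_taylor_two {f : E → G} (hf : ContDiff ℝ 3 f) (x₀ : E) :
    (fun x => f (x₀ + x) - f x₀ - fderiv ℝ f x₀ x
      - (1 / 2 : ℝ) • fderiv ℝ (fderiv ℝ f) x₀ x x) =O[𝓝 0] fun x => ‖x‖ ^ 3 := by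
  have hd : Differentiable ℝ f := hf.differentiable (by norm_num)
  have hf' : ContDiff ℝ 2 (fderiv ℝ f) := hf.fderiv_right (by norm_num)
  have hsymm : IsSymmSndFDerivAt ℝ f x₀ :=
    hf.contDiffAt.isSymmSndFDerivAt (by simp; norm_num)
  set B := fderiv ℝ (fderiv ℝ f) x₀
  have hderiv (x : E) : HasFDerivAt
      (fun x => f (x₀ + x) - f x₀ - fderiv ℝ f x₀ x - (1 / 2 : ℝ) • B x x)
      (fderiv ℝ f (x₀ + x) - fderiv ℝ f x₀ - B x) x := by
    have hquad := (B.hasFDerivAt (x := x)).clm_apply (hasFDerivAt_id x)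
    refine (((((hasFDerivAt_comp_add_left x₀).2 (hd (x₀ + x)).hasFDerivAt).sub_const (f x₀)).sub
      (fderiv ℝ f x₀).hasFDerivAt).sub (hquad.const_smul (1 / 2 : ℝ))).congr_fderiv ?_
    ext y
    have hxy : B y x = B x y := hsymm y x
    simp only [sub_apply, smul_apply, add_apply,
      ContinuousLinearMap.comp_apply, ContinuousLinearMap.flip_apply, id_eq,
      ContinuousLinearMap.id_apply, hxy]
    module
  refine isBigO_norm_pow_succ_of_fderiv (n := 2) (fun x => (hderiv x).differentiableAt)
    (by simp) ?_
  rw [funext fun x => (hderiv x).fderiv]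
  exact isBigO_taylor_one hf' x₀

end Taylor

/-- Cauchy–Schwarz for a positive operator `T`, in its dual form at `g = T u`. -/
theorem LinearMap.IsPositive.inner_sq_le {E : Type*} [NormedAddCommGroup E]
    [InnerProductSpace ℝ E] {T : E →ₗ[ℝ] E} (hT : T.IsPositive) (u x : E) :
    ⟪T u, x⟫ ^ 2 ≤ ⟪u, T u⟫ * ⟪T x, x⟫ := by
  have hdisc : discrim ⟪u, T u⟫ (2 * ⟪T u, x⟫) ⟪T x, x⟫ ≤ 0 := by
    refine discrim_le_zero fun t => ?_
    have h := hT.inner_nonneg_left (x + t • u)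
    have hsym : ⟪T x, u⟫ = ⟪T u, x⟫ := by rw [hT.isSymmetric x u, real_inner_comm]
    simp only [map_add, map_smul, inner_add_left, inner_add_right, real_inner_smul_left,
      real_inner_smul_right, hsym, real_inner_comm u (T u)] at h
    linarith
  rw [discrim] at hdisc
  linarith

theorem tendsto_rpow_nhdsGT_zero {p : ℝ} (hp : 0 < p) :
    Tendsto (fun ε : ℝ => ε ^ p) (𝓝[>] 0) (𝓝 0) := by
  have h := (Real.continuousAt_rpow_const 0 p (Or.inr hp.le)).tendsto
  rw [Real.zero_rpow hp.ne'] at h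
  exact h.mono_left nhdsWithin_le_nhds

/-- A higher power of `ε` is eventually dominated by a lower one, whatever the constant. -/
theorem eventually_mul_rpow_le_rpow (K : ℝ) {p q : ℝ} (hpq : p < q) :
    ∀ᶠ ε : ℝ in 𝓝[>] 0, K * ε ^ q ≤ ε ^ p := by
  have h : Tendsto (fun ε : ℝ => K * ε ^ (q - p)) (𝓝[>] 0) (𝓝 0) := by
    simpa using (tendsto_rpow_nhdsGT_zero (sub_pos.2 hpq)).const_mul K
  filter_upwards [h.eventually_le_const one_pos, self_mem_nhdsWithin] with ε hε hpos
  have hq : ε ^ q = ε ^ (q - p) * ε ^ p := by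
    rw [← Real.rpow_add hpos, sub_add_cancel]
  rw [hq, ← mul_assoc]
  exact mul_le_of_le_one_left (Real.rpow_nonneg (le_of_lt hpos) p) hε

section SteepestDescent

variable {E : Type*} [NormedAddCommGroup E] [InnerProductSpace ℝ E]

/-- Rescaling a fixed vector `w` with `⟪T w, w⟫ ≤ 2` by `√ε` gives eventually feasible points. -/
theorem eventually_feasible_sqrt_smul {S : E → ℝ} {θ₀ : E} {T : E →ₗ[ℝ] E}
    (hS : (fun x => S (θ₀ + x) - (1 / 2 : ℝ) * ⟪T x, x⟫) =O[𝓝 0] fun x => ‖x‖ ^ 3)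
    {c₁ c₂ : ℝ} (hc₁ : c₁ < 1 / 2) (hc₂ : c₂ < 3 / 2) {w : E} (hw : ⟪T w, w⟫ ≤ 2) :
    ∀ᶠ ε in 𝓝[>] (0 : ℝ), ‖√ε • w‖ ≤ ε ^ c₁ ∧ S (θ₀ + √ε • w) ≤ ε + ε ^ c₂ := by
  obtain ⟨C, hC⟩ := hS.bound
  have hlim : Tendsto (fun ε : ℝ => √ε • w) (𝓝[>] 0) (𝓝 0) := by
    have h : Tendsto (fun ε : ℝ => √ε • w) (𝓝 0) (𝓝 (√0 • w)) :=
      (Real.continuous_sqrt.smul continuous_const).tendsto 0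
    rw [Real.sqrt_zero, zero_smul] at h
    exact h.mono_left nhdsWithin_le_nhds
  filter_upwards [hlim.eventually hC, eventually_mul_rpow_le_rpow ‖w‖ hc₁,
    eventually_mul_rpow_le_rpow (C * ‖w‖ ^ 3) hc₂, self_mem_nhdsWithin] with ε hε h₁ h₂ hpos
  have hpos : 0 < ε := hpos
  have hnorm : ‖√ε • w‖ = ‖w‖ * ε ^ (1 / 2 : ℝ) := by
    rw [norm_smul, Real.norm_of_nonneg (Real.sqrt_nonneg ε), Real.sqrt_eq_rpow, mul_comm]
  have hcube : (ε ^ (1 / 2 : ℝ)) ^ 3 = ε ^ (3 / 2 : ℝ) := by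
    rw [← Real.rpow_mul_natCast hpos.le]; norm_num
  refine ⟨hnorm.trans_le h₁, ?_⟩
  have hquad : ⟪T (√ε • w), √ε • w⟫ = ε * ⟪T w, w⟫ := by
    rw [map_smul, real_inner_smul_left, real_inner_smul_right, ← mul_assoc,
      Real.mul_self_sqrt hpos.le]
  rw [norm_pow, norm_norm, hnorm, mul_pow, hcube, hquad] at hε
  have := (abs_le.1 hε).2
  nlinarith

/-- The linearised decrease of `F` over the feasible set, with explicit error terms. -/
theorem exists_eventually_lower_bound {F S : E → ℝ} {θ₀ u : E} {T : E →ₗ[ℝ] E}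
    (hT : T.IsPositive)
    (hF : (fun x => F (θ₀ + x) - F θ₀ - ⟪T u, x⟫) =O[𝓝 0] fun x => ‖x‖ ^ 2)
    (hS : (fun x => S (θ₀ + x) - (1 / 2 : ℝ) * ⟪T x, x⟫) =O[𝓝 0] fun x => ‖x‖ ^ 3)
    {c₁ : ℝ} (hc₁ : 0 < c₁) (c₂ : ℝ) :
    ∃ C₁ C₂ : ℝ, ∀ᶠ ε in 𝓝[>] (0 : ℝ), ∀ x : E, ‖x‖ ≤ ε ^ c₁ → S (θ₀ + x) ≤ ε + ε ^ c₂ →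
      √ε * (-√(2 * ⟪u, T u⟫ * (1 + ε ^ (c₂ - 1) + C₂ * ε ^ (3 * c₁ - 1)))
        - C₁ * ε ^ (2 * c₁ - 1 / 2)) ≤ F (θ₀ + x) - F θ₀ := by
  obtain ⟨C₁, hC₁, hb₁⟩ := hF.exists_nonneg
  obtain ⟨C₂, hC₂, hb₂⟩ := hS.exists_nonneg
  obtain ⟨δ, hδ, hball⟩ := Metric.eventually_nhds_iff.1 (hb₁.bound.and hb₂.bound)
  refine ⟨C₁, C₂, ?_⟩
  filter_upwards [(tendsto_rpow_nhdsGT_zero hc₁).eventually_lt_const hδ,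
    self_mem_nhdsWithin] with ε hεδ hpos x hx hSx
  have hpos : 0 < ε := hpos
  obtain ⟨h₁, h₂⟩ := hball (y := x) (by rw [dist_zero_right]; exact hx.trans_lt hεδ)
  rw [norm_pow, norm_norm] at h₁ h₂
  have hsq : ‖x‖ ^ 2 ≤ √ε * ε ^ (2 * c₁ - 1 / 2) := by
    rw [Real.sqrt_eq_rpow, ← Real.rpow_add hpos]
    calc ‖x‖ ^ 2 ≤ (ε ^ c₁) ^ 2 := by gcongr
      _ = _ := by rw [← Real.rpow_mul_natCast hpos.le]; congr 1; push_cast; ring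
  have hcube : ‖x‖ ^ 3 ≤ ε * ε ^ (3 * c₁ - 1) := by
    calc ‖x‖ ^ 3 ≤ (ε ^ c₁) ^ 3 := by gcongr
      _ = ε ^ (1 + (3 * c₁ - 1)) := by
        rw [← Real.rpow_mul_natCast hpos.le]; congr 1; push_cast; ring
      _ = _ := by rw [Real.rpow_add hpos, Real.rpow_one]
  have hc₂ : ε ^ c₂ = ε * ε ^ (c₂ - 1) := by
    rw [Real.rpow_sub_one hpos.ne', mul_div_cancel₀ _ hpos.ne']
  have hquad : ⟪T x, x⟫ ≤ 2 * (ε * (1 + ε ^ (c₂ - 1) + C₂ * ε ^ (3 * c₁ - 1))) := by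
    have := (abs_le.1 h₂).1
    have := mul_le_mul_of_nonneg_left hcube hC₂
    rw [hc₂] at hSx
    linarith
  have hu : 0 ≤ ⟪u, T u⟫ := hT.inner_nonneg_right u
  have hlin : -⟪T u, x⟫ ≤
      √ε * √(2 * ⟪u, T u⟫ * (1 + ε ^ (c₂ - 1) + C₂ * ε ^ (3 * c₁ - 1))) := by
    rw [← Real.sqrt_mul hpos.le]
    refine Real.le_sqrt_of_sq_le ?_
    have := hT.inner_sq_le u x
    have := mul_le_mul_of_nonneg_left hquad hu
    linarith
  have := (abs_le.1 h₁).1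
  have := mul_le_mul_of_nonneg_left hsq hC₁
  linarith

end SteepestDescent

/-- **Steepest descent characterization (SiNG direction).**
Minimizing `F` over the `S`-ball of radius `ε + ε^{c₂}` intersected with the
Euclidean ball of radius `ε^{c₁}` around `θ₀` yields, after centering and
normalizing by `√ε`, the value `-√(2⟨H⁻¹∇F(θ₀), ∇F(θ₀)⟩)` in the limit `ε → 0⁺`;
the infimum is asymptotically attained along
`Δθ_ε = -√(2ε) • H⁻¹∇F(θ₀)/√⟨H⁻¹∇F(θ₀), ∇F(θ₀)⟩`, which is eventually feasible. -/
theorem sinkhorn_natural_gradient_direction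
    {d : ℕ} (F S : EuclideanSpace ℝ (Fin d) → ℝ) (θ₀ : EuclideanSpace ℝ (Fin d))
    (hF : ContDiff ℝ 3 F) (hS : ContDiff ℝ 3 S)
    (hS_nonneg : ∀ θ, 0 ≤ S θ) (hS_zero : S θ₀ = 0)
    (H : Matrix (Fin d) (Fin d) ℝ)
    (hH : ∀ v w : EuclideanSpace ℝ (Fin d),
      ⟪Matrix.toEuclideanLin H v, w⟫ = iteratedFDeriv ℝ 2 S θ₀ ![v, w])
    (hH_posdef : H.PosDef)
    (c₁ c₂ : ℝ) (hc₁ : 1/3 < c₁ ∧ c₁ < 1/2) (hc₂ : 1 < c₂ ∧ c₂ < 3/2)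
    (m : ℝ → ℝ)
    (hm : ∀ ε : ℝ, m ε =
      sInf ((fun Δθ => F (θ₀ + Δθ)) ''
        {Δθ : EuclideanSpace ℝ (Fin d) | ‖Δθ‖ ≤ ε ^ c₁ ∧ S (θ₀ + Δθ) ≤ ε + ε ^ c₂}))
    (a : ℝ)
    (ha : a = ⟪Matrix.toEuclideanLin H⁻¹ (gradient F θ₀), gradient F θ₀⟫)
    (Δ : ℝ → EuclideanSpace ℝ (Fin d))
    (hΔ : ∀ ε : ℝ, Δ ε =
      -((Real.sqrt (2 * ε) / Real.sqrt a) •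
        Matrix.toEuclideanLin H⁻¹ (gradient F θ₀))) :
    Filter.Tendsto (fun ε => (m ε - F θ₀) / Real.sqrt ε)
      (nhdsWithin 0 (Set.Ioi 0)) (nhds (-Real.sqrt (2 * a))) ∧
    Filter.Tendsto (fun ε => (F (θ₀ + Δ ε) - F θ₀) / Real.sqrt ε)
      (nhdsWithin 0 (Set.Ioi 0)) (nhds (-Real.sqrt (2 * a))) ∧
    (∀ᶠ ε in nhdsWithin 0 (Set.Ioi 0),
      ‖Δ ε‖ ≤ ε ^ c₁ ∧ S (θ₀ + Δ ε) ≤ ε + ε ^ c₂) := by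
  set g := gradient F θ₀
  set T := Matrix.toEuclideanLin H with hT_def
  set u := Matrix.toEuclideanLin H⁻¹ g with hu
  have hT : T.IsPositive := Matrix.isPositive_toEuclideanLin_iff.2 hH_posdef.posSemidef
  have hTu : T u = g := by
    have hdet : IsUnit H.det := (Matrix.isUnit_iff_isUnit_det H).1 hH_posdef.isUnit
    simp [hT_def, hu, Matrix.toLpLin_apply, Matrix.mulVec_mulVec,
      Matrix.mul_nonsing_inv H hdet]
  have ha' : a = ⟪u, T u⟫ := by rw [ha, hTu]
  have ha0 : 0 ≤ a := ha' ▸ hT.inner_nonneg_right u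
  have hgrad (x) : fderiv ℝ F θ₀ x = ⟪g, x⟫ := inner_gradient_left.symm
  have hFd : DifferentiableAt ℝ F θ₀ := hF.differentiable (by norm_num) θ₀
  have hFT : (fun x => F (θ₀ + x) - F θ₀ - ⟪T u, x⟫) =O[𝓝 0] fun x => ‖x‖ ^ 2 := by
    simpa only [hTu, hgrad] using isBigO_taylor_one (hF.of_le (by norm_num)) θ₀
  have hST : (fun x => S (θ₀ + x) - (1 / 2 : ℝ) * ⟪T x, x⟫) =O[𝓝 0] fun x => ‖x‖ ^ 3 := by
    have hmin : IsLocalMin S θ₀ := Eventually.of_forall fun θ => hS_zero.trans_le (hS_nonneg θ)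
    have hB (x) : fderiv ℝ (fderiv ℝ S) θ₀ x x = ⟪T x, x⟫ := by
      rw [hH, iteratedFDeriv_two_apply]; rfl
    simpa [hmin.fderiv_eq_zero, hS_zero, hB] using isBigO_taylor_two hS θ₀
  set w := -((√2 / √a) • u) with hw
  have hΔw (ε) : Δ ε = √ε • w := by
    rw [hΔ, hw, Real.sqrt_mul zero_le_two, smul_neg, smul_smul]
    congr 2
    ring
  have hgw : ⟪g, w⟫ = -√(2 * a) := by
    rw [hw, inner_neg_right, real_inner_smul_right, real_inner_comm, ← ha,
      Real.sqrt_mul zero_le_two, div_mul_eq_mul_div, mul_div_assoc, Real.div_sqrt]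
  have hTw : ⟪T w, w⟫ ≤ 2 := by
    have h : ⟪T w, w⟫ = 2 * (a / a) := by
      rw [hw, map_neg, map_smul, inner_neg_neg, real_inner_smul_left, real_inner_smul_right,
        real_inner_comm, ← ha', ← mul_assoc, div_mul_div_comm, Real.mul_self_sqrt zero_le_two,
        Real.mul_self_sqrt ha0]
      ring
    linarith [div_self_le_one a]
  have hfeas : ∀ᶠ ε in 𝓝[>] (0 : ℝ), ‖Δ ε‖ ≤ ε ^ c₁ ∧ S (θ₀ + Δ ε) ≤ ε + ε ^ c₂ := by
    simpa only [hΔw] using eventually_feasible_sqrt_smul hST hc₁.2 hc₂.2 hTw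
  have hattain : Tendsto (fun ε => (F (θ₀ + Δ ε) - F θ₀) / √ε) (𝓝[>] 0) (𝓝 (-√(2 * a))) := by
    have hline := (hFd.hasFDerivAt.hasLineDerivAt w).tendsto_slope_zero_right
    have hsqrt : Tendsto Real.sqrt (𝓝[>] 0) (𝓝[>] 0) := by
      refine tendsto_nhdsWithin_iff.2 ⟨?_, ?_⟩
      · simpa using (Real.continuous_sqrt.tendsto 0).mono_left nhdsWithin_le_nhds
      · filter_upwards [self_mem_nhdsWithin] with ε hε using Real.sqrt_pos.2 hε
    have h := hline.comp hsqrt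
    rw [hgrad, hgw] at h
    refine h.congr fun ε => ?_
    simp only [Function.comp_apply, hΔw, smul_eq_mul]
    rw [div_eq_inv_mul]
  obtain ⟨C₁, C₂, hlower⟩ := exists_eventually_lower_bound hT hFT hST (c₁ := c₁) (by linarith) c₂
  have hlim : Tendsto (fun ε : ℝ => -√(2 * a * (1 + ε ^ (c₂ - 1) + C₂ * ε ^ (3 * c₁ - 1)))
      - C₁ * ε ^ (2 * c₁ - 1 / 2)) (𝓝[>] 0) (𝓝 (-√(2 * a))) := by
    have h₁ := tendsto_rpow_nhdsGT_zero (p := c₂ - 1) (by linarith)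
    have h₂ := (tendsto_rpow_nhdsGT_zero (p := 3 * c₁ - 1) (by linarith)).const_mul C₂
    have h₃ := (tendsto_rpow_nhdsGT_zero (p := 2 * c₁ - 1 / 2) (by linarith)).const_mul C₁
    simpa using ((((h₁.const_add 1).add h₂).const_mul (2 * a)).sqrt.neg).sub h₃
  have hbelow : ∀ᶠ ε in 𝓝[>] (0 : ℝ),
      √ε * (-√(2 * a * (1 + ε ^ (c₂ - 1) + C₂ * ε ^ (3 * c₁ - 1)))
        - C₁ * ε ^ (2 * c₁ - 1 / 2)) + F θ₀ ∈
      lowerBounds ((fun Δθ => F (θ₀ + Δθ)) '' {Δθ | ‖Δθ‖ ≤ ε ^ c₁ ∧ S (θ₀ + Δθ) ≤ ε + ε ^ c₂}) := by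
    filter_upwards [hlower] with ε hε
    rintro _ ⟨x, ⟨hx, hSx⟩, rfl⟩
    rw [ha']
    exact le_sub_iff_add_le.1 (hε x hx hSx)
  refine ⟨tendsto_of_tendsto_of_tendsto_of_le_of_le' hlim hattain ?_ ?_, hattain, hfeas⟩
  · filter_upwards [hbelow, hfeas, self_mem_nhdsWithin] with ε hε hΔε hpos
    rw [le_div_iff₀' (Real.sqrt_pos.2 hpos), le_sub_iff_add_le, hm]
    exact le_csInf ⟨_, Set.mem_image_of_mem _ hΔε⟩ hε
  · filter_upwards [hbelow, hfeas] with ε hε hΔε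
    rw [hm]
    gcongr
    exact csInf_le ⟨_, hε⟩ (Set.mem_image_of_mem _ hΔε)
end

section
/- Let S : ℝ^d × ℝ^d → ℝ be twice continuously differentiable in its first argument with ∇₁S(θ̄, θ̄) = 0 for every θ̄, let H(θ̄) denote the Hessian in the first argument of S at (θ̄, θ̄), assumed invertible for every θ̄, and let F : ℝ^d → ℝ be continuously differentiable. Let Φ : ℝ^d → ℝ^d be a C² diffeomorphism, and define F̃(φ̄) := F(Φ⁻¹(φ̄)) and H̃(φ̄) as the Hessian at φ = φ̄ of the map φ ↦ S(Φ⁻¹(φ), Φ⁻¹(φ̄)), assumed invertible. Suppose θ : [0,∞) → ℝ^d is differentiable and satisfies θ̇_s = −H(θ_s)⁻¹ ∇F(θ_s), and φ : [0,∞) → ℝ^d is differentiable and satisfies φ̇_s = −H̃(φ_s)⁻¹ ∇F̃(φ_s) with φ₀ = Φ(θ₀), and that solutions of the φ-differential equation with a given initial condition are unique. Then φ_s = Φ(θ_s) for all s ≥ 0. -/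
open scoped RealInnerProductSpace

/-- At a critical point of the outer function, the second derivative of a composition is the
pullback of the second derivative of the outer function. -/
theorem iteratedFDeriv_two_comp_of_fderiv_eq_zero
    {E G : Type*} [NormedAddCommGroup E] [NormedSpace ℝ E]
    [NormedAddCommGroup G] [NormedSpace ℝ G]
    {g : G → ℝ} {f : E → G} (hg : ContDiff ℝ 2 g) (hf : ContDiff ℝ 2 f) {x : E}
    (hcrit : fderiv ℝ g (f x) = 0) (v w : E) :
    iteratedFDeriv ℝ 2 (fun y => g (f y)) x ![v, w] =
      iteratedFDeriv ℝ 2 g (f x) ![fderiv ℝ f x v, fderiv ℝ f x w] := by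
  have hgd : Differentiable ℝ g := hg.differentiable (by norm_num)
  have hfd : Differentiable ℝ f := hf.differentiable (by norm_num)
  have hg' : Differentiable ℝ (fderiv ℝ g) :=
    (hg.fderiv_right (m := 1) (by norm_num)).differentiable (by norm_num)
  have hf' : Differentiable ℝ (fderiv ℝ f) :=
    (hf.fderiv_right (m := 1) (by norm_num)).differentiable (by norm_num)
  have hcomp : fderiv ℝ (fun y => g (f y)) = fun y => (fderiv ℝ g (f y)).comp (fderiv ℝ f y) :=
    funext fun y => fderiv_comp y (hgd _) (hfd y)
  have hsecond := (((hg' (f x)).hasFDerivAt.comp x (hfd x).hasFDerivAt).clm_comp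
    (hf' x).hasFDerivAt).fderiv
  simp only [Function.comp_def] at hsecond
  rw [iteratedFDeriv_two_apply, iteratedFDeriv_two_apply, hcomp, hsecond]
  simp [hcrit]

/-- The inverse of an invertible matrix sends `y` to `x` as soon as the matrix sends `x` to `y`. -/
theorem Matrix.toEuclideanLin_inv_apply_eq {n : Type*} [Fintype n] [DecidableEq n]
    {A : Matrix n n ℝ} (hA : IsUnit A) {x y : EuclideanSpace ℝ n}
    (h : Matrix.toEuclideanLin A x = y) : Matrix.toEuclideanLin A⁻¹ y = x := by
  have hdet : IsUnit A.det := (Matrix.isUnit_iff_isUnit_det A).mp hA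
  simp [← h, Matrix.toLpLin_apply, Matrix.nonsing_inv_mul A hdet]

/-- The matrix inverse is a right inverse on vectors. -/
theorem Matrix.toEuclideanLin_apply_inv_apply {n : Type*} [Fintype n] [DecidableEq n]
    {A : Matrix n n ℝ} (hA : IsUnit A) (x : EuclideanSpace ℝ n) :
    Matrix.toEuclideanLin A (Matrix.toEuclideanLin A⁻¹ x) = x := by
  have hdet : IsUnit A.det := (Matrix.isUnit_iff_isUnit_det A).mp hA
  simp [Matrix.toLpLin_apply, Matrix.mul_nonsing_inv A hdet]

/-- **Reparameterization invariance of the natural gradient flow.**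
If `θ` solves the natural gradient flow `θ̇ = -H(θ)⁻¹∇F(θ)` and `φ` solves the
flow for the reparameterized objective `F̃ = F ∘ Φ⁻¹` preconditioned by the
Hessian `H̃` of the reparameterized divergence, with `φ₀ = Φ(θ₀)`, and solutions
of the `φ`-ODE are unique, then `φ_s = Φ(θ_s)` for all `s ≥ 0`. -/
theorem natural_gradient_flow_reparameterization_invariance
    {d : ℕ}
    (S : EuclideanSpace ℝ (Fin d) → EuclideanSpace ℝ (Fin d) → ℝ)
    (F : EuclideanSpace ℝ (Fin d) → ℝ)
    (hS : ∀ θb, ContDiff ℝ 2 (fun θ => S θ θb))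
    (hS_crit : ∀ θb, gradient (fun θ => S θ θb) θb = 0)
    (H : EuclideanSpace ℝ (Fin d) → Matrix (Fin d) (Fin d) ℝ)
    (hH : ∀ θb, ∀ v w : EuclideanSpace ℝ (Fin d),
      ⟪Matrix.toEuclideanLin (H θb) v, w⟫ =
        iteratedFDeriv ℝ 2 (fun θ => S θ θb) θb ![v, w])
    (hH_inv : ∀ θb, IsUnit (H θb))
    (hF : ContDiff ℝ 1 F)
    (Φ : EuclideanSpace ℝ (Fin d) ≃ EuclideanSpace ℝ (Fin d))
    (hΦ : ContDiff ℝ 2 (Φ : EuclideanSpace ℝ (Fin d) → EuclideanSpace ℝ (Fin d)))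
    (hΦsymm : ContDiff ℝ 2
      (Φ.symm : EuclideanSpace ℝ (Fin d) → EuclideanSpace ℝ (Fin d)))
    (Ft : EuclideanSpace ℝ (Fin d) → ℝ)
    (hFt : Ft = fun φb => F (Φ.symm φb))
    (Ht : EuclideanSpace ℝ (Fin d) → Matrix (Fin d) (Fin d) ℝ)
    (hHt : ∀ φb, ∀ v w : EuclideanSpace ℝ (Fin d),
      ⟪Matrix.toEuclideanLin (Ht φb) v, w⟫ =
        iteratedFDeriv ℝ 2 (fun φ => S (Φ.symm φ) (Φ.symm φb)) φb ![v, w])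
    (hHt_inv : ∀ φb, IsUnit (Ht φb))
    (θ φ : ℝ → EuclideanSpace ℝ (Fin d))
    (hθ : ∀ s ∈ Set.Ici (0 : ℝ),
      HasDerivAt θ (-(Matrix.toEuclideanLin (H (θ s))⁻¹ (gradient F (θ s)))) s)
    (hφ : ∀ s ∈ Set.Ici (0 : ℝ),
      HasDerivAt φ (-(Matrix.toEuclideanLin (Ht (φ s))⁻¹ (gradient Ft (φ s)))) s)
    (hinit : φ 0 = Φ (θ 0))
    (huniq : ∀ ψ₁ ψ₂ : ℝ → EuclideanSpace ℝ (Fin d),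
      (∀ s ∈ Set.Ici (0 : ℝ), HasDerivAt ψ₁
        (-(Matrix.toEuclideanLin (Ht (ψ₁ s))⁻¹ (gradient Ft (ψ₁ s)))) s) →
      (∀ s ∈ Set.Ici (0 : ℝ), HasDerivAt ψ₂
        (-(Matrix.toEuclideanLin (Ht (ψ₂ s))⁻¹ (gradient Ft (ψ₂ s)))) s) →
      ψ₁ 0 = ψ₂ 0 → ∀ s ∈ Set.Ici (0 : ℝ), ψ₁ s = ψ₂ s) :
    ∀ s ∈ Set.Ici (0 : ℝ), φ s = Φ (θ s) := by
  refine huniq φ (fun s => Φ (θ s)) hφ (fun s hs => ?_) hinit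
  have hΦd := hΦ.differentiable (by norm_num) (θ s)
  have hΨd := hΦsymm.differentiable (by norm_num) (Φ (θ s))
  have hFd := hF.differentiable (by norm_num)
  have hinv (v : EuclideanSpace ℝ (Fin d)) :
      fderiv ℝ Φ.symm (Φ (θ s)) (fderiv ℝ Φ (θ s) v) = v := by
    have hcomp := hΨd.hasFDerivAt.comp (θ s) hΦd.hasFDerivAt
    rw [Equiv.symm_comp_self] at hcomp
    exact DFunLike.congr_fun (hcomp.unique (hasFDerivAt_id (θ s))) v
  have hcrit : fderiv ℝ (fun x => S x (θ s)) (Φ.symm (Φ (θ s))) = 0 := by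
    simpa [gradient] using hS_crit (θ s)
  have hFt' : HasFDerivAt Ft ((fderiv ℝ F (θ s)).comp (fderiv ℝ Φ.symm (Φ (θ s))))
      (Φ (θ s)) := by
    have hFs : HasFDerivAt F (fderiv ℝ F (θ s)) (Φ.symm (Φ (θ s))) := by
      rw [Φ.symm_apply_apply]
      exact (hFd (θ s)).hasFDerivAt
    rw [hFt]
    exact hFs.comp (Φ (θ s)) hΨd.hasFDerivAt
  set u := Matrix.toEuclideanLin (H (θ s))⁻¹ (gradient F (θ s)) with hu
  have hHt_apply : Matrix.toEuclideanLin (Ht (Φ (θ s))) (fderiv ℝ Φ (θ s) u) =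
      gradient Ft (Φ (θ s)) := by
    refine ext_inner_right ℝ fun w => ?_
    rw [hHt, Φ.symm_apply_apply,
      iteratedFDeriv_two_comp_of_fderiv_eq_zero (hS (θ s)) hΦsymm hcrit, hinv,
      Φ.symm_apply_apply, ← hH, hu, Matrix.toEuclideanLin_apply_inv_apply (hH_inv _)]
    simp [gradient, hFt'.fderiv]
  rw [Matrix.toEuclideanLin_inv_apply_eq (hHt_inv _) hHt_apply, ← map_neg]
  exact hΦd.hasFDerivAt.comp_hasDerivAt s (hθ s hs)
end

section
/- Let X ⊆ ℝ^q be compact, γ > 0, and c : X × X → ℝ continuous and G_c-Lipschitz in its second variable, i.e. |c(x, y₁) − c(x, y₂)| ≤ G_c ‖y₁ − y₂‖ for all x, y₁, y₂ ∈ X. Then for every continuous g : X → ℝ and every probability measure β on X, the function y ↦ A(g, β)(y) is G_c-Lipschitz: |A(g, β)(y₁) − A(g, β)(y₂)| ≤ G_c ‖y₁ − y₂‖ for all y₁, y₂ ∈ X. -/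
open MeasureTheory

/-- The Sinkhorn mapping `A(g, β)(y) = -γ log ∫ exp((g x - c x y)/γ) dβ(x)`. -/
noncomputable def sinkhornMap {q : ℕ} (γ : ℝ)
    (c : EuclideanSpace ℝ (Fin q) → EuclideanSpace ℝ (Fin q) → ℝ)
    (g : EuclideanSpace ℝ (Fin q) → ℝ)
    (β : Measure (EuclideanSpace ℝ (Fin q))) :
    EuclideanSpace ℝ (Fin q) → ℝ :=
  fun y => -γ * Real.log (∫ x, Real.exp ((g x - c x y) / γ) ∂β)

/-- On a set of full measure, continuity of the potential and of the cost in its first variable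
makes the Gibbs kernel integrable. -/
theorem integrable_exp_sub_div {q : ℕ} {X : Set (EuclideanSpace ℝ (Fin q))} (hX : IsCompact X)
    (γ : ℝ) {f g : EuclideanSpace ℝ (Fin q) → ℝ} (hf : ContinuousOn f X) (hg : ContinuousOn g X)
    {β : Measure (EuclideanSpace ℝ (Fin q))} [IsFiniteMeasure β] (hβ : ∀ᵐ x ∂β, x ∈ X) :
    Integrable (fun x => Real.exp ((g x - f x) / γ)) β := by
  rw [← Measure.restrict_eq_self_of_ae_mem hβ]
  exact (((hg.sub hf).div_const γ).rexp).integrableOn_compact hX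

/-- Raising the cost by at most `L` raises the Sinkhorn mapping by at most `L`. -/
theorem sinkhornMap_le_add {q : ℕ} {γ : ℝ} (hγ : 0 < γ) {L : ℝ}
    {c : EuclideanSpace ℝ (Fin q) → EuclideanSpace ℝ (Fin q) → ℝ}
    {g : EuclideanSpace ℝ (Fin q) → ℝ} {β : Measure (EuclideanSpace ℝ (Fin q))} [NeZero β]
    {y₁ y₂ : EuclideanSpace ℝ (Fin q)}
    (h₁ : Integrable (fun x => Real.exp ((g x - c x y₁) / γ)) β)
    (h₂ : Integrable (fun x => Real.exp ((g x - c x y₂) / γ)) β)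
    (hc : ∀ᵐ x ∂β, c x y₁ ≤ c x y₂ + L) :
    sinkhornMap γ c g β y₁ ≤ sinkhornMap γ c g β y₂ + L := by
  have hle : ∫ x, Real.exp ((g x - c x y₂) / γ) ∂β
      ≤ Real.exp (L / γ) * ∫ x, Real.exp ((g x - c x y₁) / γ) ∂β := by
    rw [← integral_const_mul]
    refine integral_mono_ae h₂ (h₁.const_mul _) ?_
    filter_upwards [hc] with x hx
    rw [← Real.exp_add, ← add_div]
    gcongr
    linarith
  have hlog := Real.log_le_log (integral_exp_pos h₂) hle
  rw [Real.log_mul (Real.exp_pos _).ne' (integral_exp_pos h₁).ne', Real.log_exp] at hlog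
  have hmul := mul_le_mul_of_nonneg_left hlog hγ.le
  rw [mul_add, mul_div_cancel₀ _ hγ.ne'] at hmul
  simp only [sinkhornMap]
  linarith

/-- **Lipschitz continuity of Sinkhorn potentials.** If the cost `c` is
`G_c`-Lipschitz in its second variable on `X`, then `y ↦ A(g, β)(y)` is
`G_c`-Lipschitz on `X`. -/
theorem sinkhornMap_lipschitz
    {q : ℕ} (X : Set (EuclideanSpace ℝ (Fin q))) (hX : IsCompact X)
    (γ : ℝ) (hγ : 0 < γ) (Gc : ℝ)
    (c : EuclideanSpace ℝ (Fin q) → EuclideanSpace ℝ (Fin q) → ℝ)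
    (hc_cont : ContinuousOn (fun p : EuclideanSpace ℝ (Fin q) × EuclideanSpace ℝ (Fin q) =>
      c p.1 p.2) (X ×ˢ X))
    (hc_lip : ∀ x ∈ X, ∀ y₁ ∈ X, ∀ y₂ ∈ X, |c x y₁ - c x y₂| ≤ Gc * ‖y₁ - y₂‖) :
    ∀ (g : EuclideanSpace ℝ (Fin q) → ℝ), ContinuousOn g X →
    ∀ (β : Measure (EuclideanSpace ℝ (Fin q))), IsProbabilityMeasure β → β Xᶜ = 0 →
    ∀ y₁ ∈ X, ∀ y₂ ∈ X,
      |sinkhornMap γ c g β y₁ - sinkhornMap γ c g β y₂| ≤ Gc * ‖y₁ - y₂‖ := by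
  intro g hg β hβ hβX y₁ hy₁ y₂ hy₂
  have hmem : ∀ᵐ x ∂β, x ∈ X := hβX
  have hint : ∀ y ∈ X, Integrable (fun x => Real.exp ((g x - c x y) / γ)) β := fun y hy =>
    integrable_exp_sub_div hX γ
      (hc_cont.comp (f := fun x => (x, y)) (by fun_prop) fun x hx => ⟨hx, hy⟩) hg hmem
  have hdiff : ∀ᵐ x ∂β, |c x y₁ - c x y₂| ≤ Gc * ‖y₁ - y₂‖ := by
    filter_upwards [hmem] with x hx using hc_lip x hx y₁ hy₁ y₂ hy₂
  have h₁₂ := sinkhornMap_le_add hγ (L := Gc * ‖y₁ - y₂‖) (hint y₁ hy₁) (hint y₂ hy₂) <| by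
    filter_upwards [hdiff] with x hx using by linarith [(abs_le.mp hx).2]
  have h₂₁ := sinkhornMap_le_add hγ (L := Gc * ‖y₁ - y₂‖) (hint y₂ hy₂) (hint y₁ hy₁) <| by
    filter_upwards [hdiff] with x hx using by linarith [(abs_le.mp hx).1]
  exact abs_le.mpr ⟨by linarith, by linarith⟩
end

section
/- Let X ⊆ ℝ^q be compact, γ > 0, β a probability measure on X, g : X → ℝ continuous, and suppose c : X × X → ℝ is continuous, continuously differentiable in its first variable with gradient ∇₁c bounded on X × X. Define f(x) := −γ · log ∫_X exp((g(y) − c(x, y))/γ) dβ(y) for x in the interior of X. Then f is differentiable there and ∇f(x) = ( ∫_X exp((g(y) − c(x, y))/γ) · ∇₁c(x, y) dβ(y) ) / ( ∫_X exp((g(y) − c(x, y))/γ) dβ(y) ). -/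
open MeasureTheory

/-- **Gradient formula for the Sinkhorn potential.** If
`f(x) = -γ log ∫ exp((g(y) - c(x,y))/γ) dβ(y)` with `c` continuously
differentiable in its first variable with bounded gradient `∇₁c`, then `f` is
differentiable on the interior of `X` with
`∇f(x) = (∫ exp((g(y)-c(x,y))/γ) ∇₁c(x,y) dβ(y)) / (∫ exp((g(y)-c(x,y))/γ) dβ(y))`. -/
theorem sinkhorn_potential_gradient_formula
    {q : ℕ} (X : Set (EuclideanSpace ℝ (Fin q))) (hX : IsCompact X)
    (γ : ℝ) (hγ : 0 < γ)
    (β : Measure (EuclideanSpace ℝ (Fin q))) [IsProbabilityMeasure β]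
    (hβ : β Xᶜ = 0)
    (g : EuclideanSpace ℝ (Fin q) → ℝ) (hg_cont : ContinuousOn g X)
    (c : EuclideanSpace ℝ (Fin q) → EuclideanSpace ℝ (Fin q) → ℝ)
    (hc_cont : ContinuousOn (fun p : EuclideanSpace ℝ (Fin q) × EuclideanSpace ℝ (Fin q) =>
      c p.1 p.2) (X ×ˢ X))
    (Dc : EuclideanSpace ℝ (Fin q) → EuclideanSpace ℝ (Fin q) → EuclideanSpace ℝ (Fin q))
    (hDc : ∀ y ∈ X, ∀ x ∈ interior X, HasGradientAt (fun x' => c x' y) (Dc x y) x)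
    (hDc_cont : ContinuousOn
      (fun p : EuclideanSpace ℝ (Fin q) × EuclideanSpace ℝ (Fin q) => Dc p.1 p.2)
      ((interior X) ×ˢ X))
    (Gc : ℝ) (hDc_bd : ∀ x ∈ interior X, ∀ y ∈ X, ‖Dc x y‖ ≤ Gc)
    (f : EuclideanSpace ℝ (Fin q) → ℝ)
    (hf : ∀ x, f x = -γ * Real.log (∫ y, Real.exp ((g y - c x y) / γ) ∂β)) :
    ∀ x ∈ interior X, HasGradientAt f
      ((∫ y, Real.exp ((g y - c x y) / γ) ∂β)⁻¹ •
        ∫ y, Real.exp ((g y - c x y) / γ) • Dc x y ∂β) x := by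
  intro x hx
  have h_restrict : β.restrict X = β :=
    Measure.restrict_eq_self_of_ae_mem (mem_ae_iff.mpr hβ)
  have h_ae : ∀ᵐ y ∂β, y ∈ X := mem_ae_iff.mpr hβ
  have h_sub : interior X ⊆ X := interior_subset
  have hF_cont : ContinuousOn
      (fun p : EuclideanSpace ℝ (Fin q) × EuclideanSpace ℝ (Fin q) =>
        Real.exp ((g p.2 - c p.1 p.2) / γ)) (X ×ˢ X) :=
    Real.continuous_exp.comp_continuousOn
      (((hg_cont.comp continuousOn_snd fun p hp => hp.2).sub hc_cont).div_const γ)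
  have hF_slice : ∀ x' ∈ X, ContinuousOn (fun y => Real.exp ((g y - c x' y) / γ)) X :=
    fun x' hx' => hF_cont.comp (f := fun y => (x', y)) (by fun_prop) fun y hy => ⟨hx', hy⟩
  have hD_slice : ContinuousOn (fun y => Dc x y) X :=
    hDc_cont.comp (f := fun y => (x, y)) (by fun_prop) fun y hy => ⟨hx, hy⟩
  have h_meas : ∀ {G : Type} [NormedAddCommGroup G]
      {u : EuclideanSpace ℝ (Fin q) → G}, ContinuousOn u X →
      AEStronglyMeasurable u β := fun hu => by
    rw [← h_restrict]
    exact hu.aestronglyMeasurable_of_isCompact hX hX.measurableSet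
  have h_int : ∀ {G : Type} [NormedAddCommGroup G]
      {u : EuclideanSpace ℝ (Fin q) → G}, ContinuousOn u X →
      Integrable u β := fun hu => by
    rw [← h_restrict]
    exact hu.integrableOn_compact hX
  obtain ⟨M, hM⟩ := (hX.prod hX).exists_bound_of_continuousOn hF_cont
  have hF_deriv : ∀ y ∈ X, ∀ x' ∈ interior X,
      HasFDerivAt (fun z => Real.exp ((g y - c z y) / γ))
        (innerSL ℝ ((-γ⁻¹) • Real.exp ((g y - c x' y) / γ) • Dc x' y)) x' := by
    intro y hy x' hx'
    have h := (((hDc y hy x' hx').hasFDerivAt.const_sub (g y)).mul_const γ⁻¹).exp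
    refine h.congr_fderiv ?_
    ext v
    simp [div_eq_mul_inv]
    ring
  have h_deriv := hasFDerivAt_integral_of_dominated_of_fderiv_le (μ := β) (𝕜 := ℝ)
    (F := fun z y => Real.exp ((g y - c z y) / γ))
    (F' := fun z y => innerSL ℝ ((-γ⁻¹) • Real.exp ((g y - c z y) / γ) • Dc z y))
    (bound := fun _ => γ⁻¹ * (M * Gc)) (isOpen_interior.mem_nhds hx)
    (Filter.eventually_of_mem (isOpen_interior.mem_nhds hx)
      fun z hz => h_meas (hF_slice z (h_sub hz)))
    (h_int (hF_slice x (h_sub hx)))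
    (h_meas ((innerSL ℝ).continuous.comp_continuousOn
      (((hF_slice x (h_sub hx)).smul hD_slice).const_smul (-γ⁻¹))))
    (h_ae.mono fun y hy z hz => by
      have h_exp := hM (z, y) ⟨h_sub hz, hy⟩
      rw [innerSL_apply_norm, norm_smul, norm_smul, norm_neg, norm_inv, Real.norm_of_nonneg hγ.le]
      gcongr
      · exact (norm_nonneg _).trans h_exp
      · exact hDc_bd z hz y hy)
    (integrable_const _)
    (h_ae.mono fun y hy z hz => hF_deriv y hy z hz)
  have h_pos : 0 < ∫ y, Real.exp ((g y - c x y) / γ) ∂β :=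
    integral_exp_pos (h_int (hF_slice x (h_sub hx)))
  have h_log := (h_deriv.log h_pos.ne').const_mul (-γ)
  rw [funext hf, hasGradientAt_iff_hasFDerivAt]
  refine h_log.congr_fderiv ?_
  have h_int_D : Integrable (fun y => (-γ⁻¹) • Real.exp ((g y - c x y) / γ) • Dc x y) β :=
    h_int (((hF_slice x (h_sub hx)).smul hD_slice).const_smul (-γ⁻¹))
  rw [(innerSL ℝ).integral_comp_comm h_int_D, integral_smul]
  ext v
  simp
  field_simp
  rfl
end

section
/- Let X ⊆ ℝ^q be compact, γ > 0, and c : X × X → ℝ continuous with 0 ≤ c(x,y) ≤ M_c, G_c-Lipschitz in each variable, twice continuously differentiable in its first variable with ‖∇₁c‖ ≤ G_c, ∇₁c L_c-Lipschitz, and ∇²₁₁c L_{2,c}-Lipschitz in the first variable. Then there exists a constant C, depending only on M_c, G_c, L_c, L_{2,c} and γ, such that for all probability measures α, α', β on X and all Sinkhorn potential pairs (f, g) for (α, β) and (f', g') for (α', β) (i.e. g = A(f, α), f = A(g, β), g' = A(f', α'), f' = A(g', β), normalized so that f(x₀) = f'(x₀) = 0 at a common point x₀ ∈ X), one has sup_{x}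 ‖∇²f(x) − ∇²f'(x)‖_op ≤ C · d_bl(α, α'). -/
open MeasureTheory

/-- The bounded-Lipschitz metric on measures supported in `X`. -/
noncomputable def dblOn {q : ℕ} (X : Set (EuclideanSpace ℝ (Fin q)))
    (α α' : Measure (EuclideanSpace ℝ (Fin q))) : ℝ :=
  sSup {r : ℝ | ∃ ξ : EuclideanSpace ℝ (Fin q) → ℝ,
    (∀ x ∈ X, |ξ x| ≤ 1) ∧ LipschitzOnWith 1 ξ X ∧
    r = |(∫ x, ξ x ∂α) - (∫ x, ξ x ∂α')|}

section SoftMin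

variable {S : Type*} [TopologicalSpace S] [T2Space S] [MeasurableSpace S]
  [BorelSpace S] {X : Set S} {μ : Measure S} {γ : ℝ}

lemma ContinuousOn.integrable_of_isCompact_of_ae_mem [IsFiniteMeasure μ] {f : S → ℝ}
    (hf : ContinuousOn f X) (hX : IsCompact X) (hμ : ∀ᵐ x ∂μ, x ∈ X) : Integrable f μ := by
  obtain ⟨K, hK⟩ := hX.exists_bound_of_continuousOn hf
  have hm : AEStronglyMeasurable f (μ.restrict X) := by
    apply AEMeasurable.aestronglyMeasurable
    exact hf.aemeasurable hX.measurableSet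
  rw [Measure.restrict_eq_self_of_ae_mem hμ] at hm
  exact Integrable.of_bound hm K (hμ.mono fun x hx => hK x hx)

/-- The soft minimum of `-w` with temperature `γ` with respect to the measure `μ`. -/
noncomputable def softMin (γ : ℝ) (μ : Measure S) (w : S → ℝ) : ℝ :=
  -γ * Real.log (∫ x, Real.exp (w x / γ) ∂μ)

lemma ContinuousOn.integrable_exp_div [IsFiniteMeasure μ] {w : S → ℝ}
    (hw : ContinuousOn w X) (hX : IsCompact X) (hμ : ∀ᵐ x ∂μ, x ∈ X) :
    Integrable (fun x => Real.exp (w x / γ)) μ :=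
  ContinuousOn.integrable_of_isCompact_of_ae_mem (hw.div_const γ).rexp hX hμ

lemma integral_exp_div_pos [IsProbabilityMeasure μ] {w : S → ℝ}
    (hw : ContinuousOn w X) (hX : IsCompact X) (hμ : ∀ᵐ x ∂μ, x ∈ X) :
    0 < ∫ x, Real.exp (w x / γ) ∂μ :=
  integral_exp_pos (hw.integrable_exp_div hX hμ)

lemma exp_neg_softMin_div [IsProbabilityMeasure μ] {w : S → ℝ} (hγ : 0 < γ)
    (hw : ContinuousOn w X) (hX : IsCompact X) (hμ : ∀ᵐ x ∂μ, x ∈ X) :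
    Real.exp (-softMin γ μ w / γ) = ∫ x, Real.exp (w x / γ) ∂μ := by
  have h : -softMin γ μ w / γ = Real.log (∫ x, Real.exp (w x / γ) ∂μ) := by
    unfold softMin; field_simp
  rw [h, Real.exp_log (integral_exp_div_pos hw hX hμ)]

lemma softMin_le_softMin_add [IsProbabilityMeasure μ] {w₁ w₂ : S → ℝ} {t : ℝ} (hγ : 0 < γ)
    (hX : IsCompact X) (hμ : ∀ᵐ x ∂μ, x ∈ X)
    (hw₁ : ContinuousOn w₁ X) (hw₂ : ContinuousOn w₂ X) (h : ∀ x ∈ X, w₁ x ≤ w₂ x + t) :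
    softMin γ μ w₂ ≤ softMin γ μ w₁ + t := by
  have key : ∫ x, Real.exp (w₁ x / γ) ∂μ ≤ (∫ x, Real.exp (w₂ x / γ) ∂μ) * Real.exp (t / γ) := by
    rw [← integral_mul_const]
    apply integral_mono_ae (hw₁.integrable_exp_div hX hμ)
      ((hw₂.integrable_exp_div hX hμ).mul_const _)
    filter_upwards [hμ] with x hx
    rw [← Real.exp_add, ← add_div]
    exact Real.exp_le_exp.2 (div_le_div_of_nonneg_right (h x hx) hγ.le)
  rw [← exp_neg_softMin_div hγ hw₁ hX hμ, ← exp_neg_softMin_div hγ hw₂ hX hμ,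
    ← Real.exp_add, ← add_div, Real.exp_le_exp, div_le_div_iff_of_pos_right hγ] at key
  linarith

/-- The soft minimum contracts oscillations when the cost is bounded. -/
lemma softMin_contraction [IsProbabilityMeasure μ] {u v k₁ k₂ : S → ℝ} {M D : ℝ} (hγ : 0 < γ)
    (hX : IsCompact X) (hμ : ∀ᵐ x ∂μ, x ∈ X)
    (hu : ContinuousOn u X) (hv : ContinuousOn v X)
    (hk₁ : ContinuousOn k₁ X) (hk₂ : ContinuousOn k₂ X)
    (hb₁ : ∀ x ∈ X, 0 ≤ k₁ x ∧ k₁ x ≤ M) (hb₂ : ∀ x ∈ X, 0 ≤ k₂ x ∧ k₂ x ≤ M)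
    (hD : ∀ x ∈ X, ∀ x' ∈ X, (u x - v x) - (u x' - v x') ≤ D) :
    (softMin γ μ (fun x => u x - k₁ x) - softMin γ μ (fun x => v x - k₁ x)) -
      (softMin γ μ (fun x => u x - k₂ x) - softMin γ μ (fun x => v x - k₂ x)) ≤
      (1 - Real.exp (-(2 * M) / γ)) * D := by
  have hne : X.Nonempty := hμ.exists
  obtain ⟨z, hz, hzmin⟩ := hX.exists_isMinOn hne (hu.sub hv)
  have hmin : ∀ x ∈ X, u z - v z ≤ u x - v x := fun x hx => hzmin hx
  set m := u z - v z with hm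
  set U₁ := ∫ x, Real.exp ((u x - k₁ x) / γ) ∂μ with hU₁
  set U₂ := ∫ x, Real.exp ((u x - k₂ x) / γ) ∂μ with hU₂
  set V₁ := ∫ x, Real.exp ((v x - k₁ x) / γ) ∂μ with hV₁
  set V₂ := ∫ x, Real.exp ((v x - k₂ x) / γ) ∂μ with hV₂
  have iU₁ : Integrable (fun x => Real.exp ((u x - k₁ x) / γ)) μ :=
    (hu.sub hk₁).integrable_exp_div hX hμ
  have iU₂ : Integrable (fun x => Real.exp ((u x - k₂ x) / γ)) μ :=
    (hu.sub hk₂).integrable_exp_div hX hμ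
  have iV₁ : Integrable (fun x => Real.exp ((v x - k₁ x) / γ)) μ :=
    (hv.sub hk₁).integrable_exp_div hX hμ
  have iV₂ : Integrable (fun x => Real.exp ((v x - k₂ x) / γ)) μ :=
    (hv.sub hk₂).integrable_exp_div hX hμ
  have pU₁ : 0 < U₁ := integral_exp_div_pos (hu.sub hk₁) hX hμ
  have pU₂ : 0 < U₂ := integral_exp_div_pos (hu.sub hk₂) hX hμ
  have pV₁ : 0 < V₁ := integral_exp_div_pos (hv.sub hk₁) hX hμ
  have pV₂ : 0 < V₂ := integral_exp_div_pos (hv.sub hk₂) hX hμ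
  set e := Real.exp (-M / γ) with he
  have pe : 0 < e := Real.exp_pos _
  have hee : Real.exp (-(2 * M) / γ) = e * e := by
    rw [he, ← Real.exp_add]; congr 1; ring
  have hM : 0 ≤ M := (hb₁ z hz).1.trans (hb₁ z hz).2
  have he1 : e ≤ 1 := Real.exp_le_one_iff.2 (div_nonpos_of_nonpos_of_nonneg (by linarith) hγ.le)
  have hV : e * V₁ ≤ V₂ := by
    rw [hV₁, hV₂, ← integral_const_mul]
    apply integral_mono_ae (iV₁.const_mul _) iV₂
    filter_upwards [hμ] with x hx
    rw [he, ← Real.exp_add, ← add_div]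
    exact Real.exp_le_exp.2 (div_le_div_of_nonneg_right
      (by have := hb₁ x hx; have := hb₂ x hx; linarith) hγ.le)
  have hU : e * (U₂ - Real.exp (m / γ) * V₂) ≤ U₁ - Real.exp (m / γ) * V₁ := by
    rw [hU₁, hU₂, hV₁, hV₂, ← integral_const_mul, ← integral_const_mul,
      ← integral_sub iU₂ (iV₂.const_mul _), ← integral_sub iU₁ (iV₁.const_mul _),
      ← integral_const_mul]
    apply integral_mono_ae ((iU₂.sub (iV₂.const_mul _)).const_mul _) (iU₁.sub (iV₁.const_mul _))
    filter_upwards [hμ] with x hx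
    have h1 : ∀ k : ℝ, Real.exp ((u x - k) / γ) - Real.exp (m / γ) * Real.exp ((v x - k) / γ) =
        (Real.exp ((u x - v x) / γ) - Real.exp (m / γ)) * Real.exp ((v x - k) / γ) := by
      intro k
      rw [sub_mul, ← Real.exp_add ((u x - v x) / γ)]
      congr 2; ring
    have h2 : Real.exp (m / γ) ≤ Real.exp ((u x - v x) / γ) :=
      Real.exp_le_exp.2 (div_le_div_of_nonneg_right (hmin x hx) hγ.le)
    have h3 : e * Real.exp ((v x - k₂ x) / γ) ≤ Real.exp ((v x - k₁ x) / γ) := by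
      rw [he, ← Real.exp_add, ← add_div]
      exact Real.exp_le_exp.2 (div_le_div_of_nonneg_right
        (by have := hb₁ x hx; have := hb₂ x hx; linarith) hγ.le)
    simp only [Pi.sub_apply, h1]
    calc _ = (Real.exp ((u x - v x) / γ) - Real.exp (m / γ)) *
          (e * Real.exp ((v x - k₂ x) / γ)) := by ring
      _ ≤ _ := mul_le_mul_of_nonneg_left h3 (sub_nonneg.2 h2)
  have hlow : Real.exp (m / γ) * V₂ ≤ U₂ := by
    rw [hU₂, hV₂, ← integral_const_mul]
    apply integral_mono_ae (iV₂.const_mul _) iU₂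
    filter_upwards [hμ] with x hx
    rw [← Real.exp_add, ← add_div]
    exact Real.exp_le_exp.2 (div_le_div_of_nonneg_right (by linarith [hmin x hx]) hγ.le)
  have hup : U₂ ≤ Real.exp ((m + D) / γ) * V₂ := by
    rw [hU₂, hV₂, ← integral_const_mul]
    apply integral_mono_ae iU₂ (iV₂.const_mul _)
    filter_upwards [hμ] with x hx
    rw [← Real.exp_add, ← add_div]
    exact Real.exp_le_exp.2 (div_le_div_of_nonneg_right (by linarith [hD x hx z hz]) hγ.le)
  have hA : e * e * (U₂ / V₂) + (1 - e * e) * Real.exp (m / γ) ≤ U₁ / V₁ := by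
    have h1 : e * (U₂ - Real.exp (m / γ) * V₂) / V₁ ≤ (U₁ - Real.exp (m / γ) * V₁) / V₁ :=
      div_le_div_of_nonneg_right hU pV₁.le
    have h2 : e * e * ((U₂ - Real.exp (m / γ) * V₂) / V₂) ≤
        e * (U₂ - Real.exp (m / γ) * V₂) / V₁ := by
      rw [mul_div_assoc', div_le_div_iff₀ pV₂ pV₁]
      have := mul_le_mul_of_nonneg_left hV (mul_nonneg pe.le (sub_nonneg.2 hlow))
      nlinarith
    have h3 : (U₁ - Real.exp (m / γ) * V₁) / V₁ = U₁ / V₁ - Real.exp (m / γ) := by field_simp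
    have h4 : (U₂ - Real.exp (m / γ) * V₂) / V₂ = U₂ / V₂ - Real.exp (m / γ) := by field_simp
    rw [h3] at h1
    rw [h4] at h2
    linarith
  have hee1 : e * e ≤ 1 := mul_le_one₀ he1 pe.le he1
  have hlog : e * e * Real.log (U₂ / V₂) + (1 - e * e) * (m / γ) ≤ Real.log (U₁ / V₁) := by
    have hc := strictConcaveOn_log_Ioi.concaveOn.2 (x := U₂ / V₂) (y := Real.exp (m / γ))
      (Set.mem_Ioi.2 (div_pos pU₂ pV₂)) (Set.mem_Ioi.2 (Real.exp_pos _))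
      (mul_nonneg pe.le pe.le) (sub_nonneg.2 hee1) (by ring)
    simp only [smul_eq_mul, Real.log_exp] at hc
    refine hc.trans (Real.log_le_log ?_ hA)
    have := mul_pos (mul_pos pe pe) (div_pos pU₂ pV₂)
    have := mul_nonneg (sub_nonneg.2 hee1) (Real.exp_pos (m / γ)).le
    linarith
  have hlog2 : Real.log (U₂ / V₂) ≤ (m + D) / γ := by
    rw [Real.log_le_iff_le_exp (div_pos pU₂ pV₂), div_le_iff₀ pV₂]
    exact hup
  have hfin : Real.log (U₂ / V₂) - Real.log (U₁ / V₁) ≤ (1 - e * e) * (D / γ) := by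
    have := mul_le_mul_of_nonneg_left hlog2 (sub_nonneg.2 hee1)
    rw [add_div] at this
    linarith
  rw [Real.log_div pU₂.ne' pV₂.ne', Real.log_div pU₁.ne' pV₁.ne'] at hfin
  have := mul_le_mul_of_nonneg_left hfin hγ.le
  rw [hee]
  have h5 : γ * ((1 - e * e) * (D / γ)) = (1 - e * e) * D := by field_simp
  rw [h5] at this
  simp only [softMin]
  linarith

end SoftMin

section BoundedLipschitz

variable {q : ℕ} {X : Set (EuclideanSpace ℝ (Fin q))} {α α' : Measure (EuclideanSpace ℝ (Fin q))}
  [IsProbabilityMeasure α] [IsProbabilityMeasure α']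

lemma abs_integral_sub_le_dblOn (hα : ∀ᵐ x ∂α, x ∈ X) (hα' : ∀ᵐ x ∂α', x ∈ X)
    {ξ : EuclideanSpace ℝ (Fin q) → ℝ} (hb : ∀ x ∈ X, |ξ x| ≤ 1) (hl : LipschitzOnWith 1 ξ X) :
    |(∫ x, ξ x ∂α) - (∫ x, ξ x ∂α')| ≤ dblOn X α α' := by
  refine le_csSup ⟨2, ?_⟩ ⟨ξ, hb, hl, rfl⟩
  rintro r ⟨ζ, hζ, -, rfl⟩
  have h1 := norm_integral_le_of_norm_le_const (μ := α) (f := ζ) (C := 1) (hα.mono hζ)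
  have h2 := norm_integral_le_of_norm_le_const (μ := α') (f := ζ) (C := 1) (hα'.mono hζ)
  simp only [probReal_univ, mul_one, Real.norm_eq_abs] at h1 h2
  exact (abs_sub _ _).trans (by linarith)

lemma dblOn_nonneg (X : Set (EuclideanSpace ℝ (Fin q)))
    (α α' : Measure (EuclideanSpace ℝ (Fin q))) : 0 ≤ dblOn X α α' :=
  Real.sSup_nonneg (by rintro r ⟨ξ, -, -, rfl⟩; exact abs_nonneg _)

lemma abs_integral_sub_le_mul_dblOn (hα : ∀ᵐ x ∂α, x ∈ X) (hα' : ∀ᵐ x ∂α', x ∈ X)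
    {ξ : EuclideanSpace ℝ (Fin q) → ℝ} {R : ℝ} (hR : 0 < R) (hb : ∀ x ∈ X, |ξ x| ≤ R)
    (hl : ∀ x ∈ X, ∀ x' ∈ X, |ξ x - ξ x'| ≤ R * ‖x - x'‖) :
    |(∫ x, ξ x ∂α) - (∫ x, ξ x ∂α')| ≤ R * dblOn X α α' := by
  have h := abs_integral_sub_le_dblOn hα hα' (ξ := fun x => R⁻¹ * ξ x)
    (fun x hx => by
      rw [abs_mul, abs_of_pos (inv_pos.2 hR), inv_mul_le_iff₀ hR, mul_one]; exact hb x hx)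
    (LipschitzOnWith.of_dist_le_mul fun x hx x' hx' => by
      rw [Real.dist_eq, ← mul_sub, abs_mul, abs_of_pos (inv_pos.2 hR), inv_mul_le_iff₀ hR,
        dist_eq_norm, NNReal.coe_one, one_mul]
      exact hl x hx x' hx')
  rw [integral_const_mul, integral_const_mul, ← mul_sub, abs_mul, abs_of_pos (inv_pos.2 hR),
    inv_mul_le_iff₀ hR] at h
  exact h

lemma abs_exp_sub_exp_le {a b B : ℝ} (ha : a ≤ B) (hb : b ≤ B) :
    |Real.exp a - Real.exp b| ≤ Real.exp B * |a - b| := by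
  wlog hab : b ≤ a generalizing a b
  · rw [abs_sub_comm, abs_sub_comm a]; exact this hb ha (le_of_not_ge hab)
  rw [abs_of_nonneg (sub_nonneg.2 (Real.exp_le_exp.2 hab)), abs_of_nonneg (sub_nonneg.2 hab)]
  have h1 : Real.exp b = Real.exp a * Real.exp (b - a) := by rw [← Real.exp_add]; congr 1; ring
  have h2 := Real.add_one_le_exp (b - a)
  have h3 := Real.exp_le_exp.2 ha
  have h4 := Real.exp_pos a
  calc Real.exp a - Real.exp b = Real.exp a * (1 - Real.exp (b - a)) := by rw [h1]; ring
    _ ≤ Real.exp a * (a - b) := mul_le_mul_of_nonneg_left (by linarith) h4.le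
    _ ≤ _ := mul_le_mul_of_nonneg_right h3 (sub_nonneg.2 hab)

lemma abs_log_sub_log_le {a b l : ℝ} (hl : 0 < l) (ha : l ≤ a) (hb : l ≤ b) :
    |Real.log a - Real.log b| ≤ l⁻¹ * |a - b| := by
  wlog hab : b ≤ a generalizing a b
  · rw [abs_sub_comm, abs_sub_comm a]; exact this hb ha (le_of_not_ge hab)
  have pb := hl.trans_le hb
  have pa := hl.trans_le ha
  rw [abs_of_nonneg (sub_nonneg.2 (Real.log_le_log pb hab)), abs_of_nonneg (sub_nonneg.2 hab),
    ← Real.log_div pa.ne' pb.ne']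
  calc Real.log (a / b) ≤ a / b - 1 := Real.log_le_sub_one_of_pos (div_pos pa pb)
    _ = b⁻¹ * (a - b) := by field_simp
    _ ≤ _ := mul_le_mul_of_nonneg_right ((inv_le_inv₀ pb hl).2 hb) (sub_nonneg.2 hab)

/-- Stability of the soft minimum of a Lipschitz function with respect to the measure. -/
lemma abs_softMin_sub_softMin_le {γ a b L : ℝ} {w : EuclideanSpace ℝ (Fin q) → ℝ} (hγ : 0 < γ)
    (hL : 0 ≤ L) (hX : IsCompact X) (hα : ∀ᵐ x ∂α, x ∈ X) (hα' : ∀ᵐ x ∂α', x ∈ X)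
    (hw : ContinuousOn w X) (hwa : ∀ x ∈ X, a ≤ w x) (hwb : ∀ x ∈ X, w x ≤ b)
    (hwl : ∀ x ∈ X, ∀ x' ∈ X, |w x - w x'| ≤ L * ‖x - x'‖) :
    |softMin γ α w - softMin γ α' w| ≤
      γ * (Real.exp (-a / γ) * (Real.exp (b / γ) * (1 + L / γ))) * dblOn X α α' := by
  have low : ∀ (μ : Measure (EuclideanSpace ℝ (Fin q))) [IsProbabilityMeasure μ],
      (∀ᵐ x ∂μ, x ∈ X) → Real.exp (a / γ) ≤ ∫ x, Real.exp (w x / γ) ∂μ := by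
    intro μ _ hμ
    have := integral_mono_ae (integrable_const (Real.exp (a / γ))) (hw.integrable_exp_div hX hμ)
      (hμ.mono fun x hx => Real.exp_le_exp.2 (div_le_div_of_nonneg_right (hwa x hx) hγ.le))
    simpa using this
  have hLγ : 0 ≤ L / γ := div_nonneg hL hγ.le
  have h1 := abs_integral_sub_le_mul_dblOn hα hα' (ξ := fun x => Real.exp (w x / γ))
    (R := Real.exp (b / γ) * (1 + L / γ)) (mul_pos (Real.exp_pos _) (by linarith))
    (fun x hx => by
      rw [abs_of_pos (Real.exp_pos _)]
      have := Real.exp_le_exp.2 (div_le_div_of_nonneg_right (hwb x hx) hγ.le)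
      nlinarith [Real.exp_pos (b / γ), mul_nonneg (Real.exp_pos (b / γ)).le hLγ])
    (fun x hx x' hx' => by
      refine (abs_exp_sub_exp_le (div_le_div_of_nonneg_right (hwb x hx) hγ.le)
        (div_le_div_of_nonneg_right (hwb x' hx') hγ.le)).trans ?_
      rw [mul_assoc]
      refine mul_le_mul_of_nonneg_left ?_ (Real.exp_pos _).le
      rw [← sub_div, abs_div, abs_of_pos hγ]
      have := div_le_div_of_nonneg_right (hwl x hx x' hx') hγ.le
      rw [mul_div_right_comm] at this
      nlinarith [norm_nonneg (x - x')])
  have h2 := abs_log_sub_log_le (Real.exp_pos _) (low α hα) (low α' hα')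
  rw [← Real.exp_neg, ← neg_div] at h2
  have h3 : softMin γ α w - softMin γ α' w = -γ * (Real.log (∫ x, Real.exp (w x / γ) ∂α) -
      Real.log (∫ x, Real.exp (w x / γ) ∂α')) := by simp only [softMin]; ring
  rw [h3, abs_mul, abs_neg, abs_of_pos hγ, mul_assoc γ, mul_assoc (Real.exp (-a / γ))]
  exact mul_le_mul_of_nonneg_left
    (h2.trans (mul_le_mul_of_nonneg_left h1 (Real.exp_pos _).le)) hγ.le

end BoundedLipschitz

section Sinkhorn

/-- Continuous costs on `X` with values in `[0, M]`, `G`-Lipschitz in each variable. -/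
structure IsLipschitzCost {E : Type*} [SeminormedAddCommGroup E] (X : Set E) (c : E → E → ℝ)
    (M G : ℝ) : Prop where
  continuousOn : ContinuousOn (fun p : E × E => c p.1 p.2) (X ×ˢ X)
  mem_Icc : ∀ x ∈ X, ∀ y ∈ X, 0 ≤ c x y ∧ c x y ≤ M
  lipschitz_left : ∀ y ∈ X, ∀ x ∈ X, ∀ x' ∈ X, |c x y - c x' y| ≤ G * ‖x - x'‖

/-- `(f, g)` are Sinkhorn potentials on `X` for the marginals `α` and `β`. -/
structure IsSinkhornPair {E : Type*} [TopologicalSpace E] [MeasurableSpace E] (γ : ℝ) (X : Set E)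
    (c : E → E → ℝ) (α β : Measure E) (f g : E → ℝ) : Prop where
  continuousOn_left : ContinuousOn f X
  continuousOn_right : ContinuousOn g X
  right_eq : ∀ y ∈ X, g y = -γ * Real.log (∫ x, Real.exp ((f x - c x y) / γ) ∂α)
  left_eq : ∀ x ∈ X, f x = -γ * Real.log (∫ y, Real.exp ((g y - c x y) / γ) ∂β)

/-- The density with respect to `α ⊗ β` of the plan associated with the potentials `(f, g)`. -/
noncomputable def gibbsKernel {E : Type*} (γ : ℝ) (c : E → E → ℝ) (f g : E → ℝ) (x y : E) : ℝ :=
  Real.exp ((f x + g y - c x y) / γ)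

lemma softMin_const {S : Type*} [TopologicalSpace S] [MeasurableSpace S] {γ : ℝ}
    (hγ : 0 < γ) (μ : Measure S) [IsProbabilityMeasure μ] (a : ℝ) :
    softMin γ μ (fun _ => a) = -a := by
  simp only [softMin, integral_const, probReal_univ, one_smul, Real.log_exp]
  field_simp

namespace IsLipschitzCost

variable {E : Type*} [NormedAddCommGroup E] {X : Set E} {c : E → E → ℝ} {M G : ℝ}

lemma continuousOn_left (hc : IsLipschitzCost X c M G) {y : E} (hy : y ∈ X) :
    ContinuousOn (fun x => c x y) X :=
  hc.continuousOn.comp (f := fun x => (x, y)) (by fun_prop) fun _ hx => ⟨hx, hy⟩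

lemma continuousOn_right (hc : IsLipschitzCost X c M G) {x : E} (hx : x ∈ X) :
    ContinuousOn (fun y => c x y) X :=
  hc.continuousOn.comp (f := fun y => (x, y)) (by fun_prop) fun _ hy => ⟨hx, hy⟩

end IsLipschitzCost

namespace IsSinkhornPair

variable {E : Type*} [NormedAddCommGroup E] [MeasurableSpace E] {γ M G : ℝ}
  {X : Set E} {c : E → E → ℝ} {α β : Measure E} {f g : E → ℝ}

lemma continuousOn_gibbsKernel (P : IsSinkhornPair γ X c α β f g) (hc : IsLipschitzCost X c M G)
    {x : E} (hx : x ∈ X) : ContinuousOn (gibbsKernel γ c f g x) X :=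
  (((continuousOn_const.add P.continuousOn_right).sub (hc.continuousOn_right hx)).div_const γ).rexp

variable [BorelSpace E] [IsProbabilityMeasure β]

lemma left_sub_le (P : IsSinkhornPair γ X c α β f g) (hc : IsLipschitzCost X c M G) (hγ : 0 < γ)
    (hX : IsCompact X) (hβ : ∀ᵐ x ∂β, x ∈ X) {x x' : E} (hx : x ∈ X) (hx' : x' ∈ X) {t : ℝ}
    (h : ∀ y ∈ X, c x y - c x' y ≤ t) : f x - f x' ≤ t := by
  have := softMin_le_softMin_add (t := t) hγ hX hβ
    (P.continuousOn_right.sub (hc.continuousOn_right hx'))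
    (P.continuousOn_right.sub (hc.continuousOn_right hx))
    (fun y hy => by have := h y hy; simp only [Pi.sub_apply]; linarith)
  have h1 := P.left_eq x hx
  have h2 := P.left_eq x' hx'
  simp only [softMin, Pi.sub_apply] at this
  linarith

lemma left_sub_le_bound (P : IsSinkhornPair γ X c α β f g) (hc : IsLipschitzCost X c M G)
    (hγ : 0 < γ) (hX : IsCompact X) (hβ : ∀ᵐ x ∂β, x ∈ X) {x x' : E} (hx : x ∈ X) (hx' : x' ∈ X) :
    f x - f x' ≤ M :=
  P.left_sub_le hc hγ hX hβ hx hx' fun y hy => by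
    linarith [hc.mem_Icc x hx y hy, hc.mem_Icc x' hx' y hy]

lemma abs_left_sub_le (P : IsSinkhornPair γ X c α β f g) (hc : IsLipschitzCost X c M G)
    (hγ : 0 < γ) (hX : IsCompact X) (hβ : ∀ᵐ x ∂β, x ∈ X) {x x' : E} (hx : x ∈ X) (hx' : x' ∈ X) :
    |f x - f x'| ≤ G * ‖x - x'‖ := by
  rw [abs_sub_le_iff]
  exact ⟨P.left_sub_le hc hγ hX hβ hx hx' fun y hy =>
      (abs_sub_le_iff.1 (hc.lipschitz_left y hy x hx x' hx')).1,
    P.left_sub_le hc hγ hX hβ hx' hx fun y hy =>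
      (abs_sub_le_iff.1 (hc.lipschitz_left y hy x hx x' hx')).2⟩

lemma left_add_right_le [IsProbabilityMeasure α] (P : IsSinkhornPair γ X c α β f g)
    (hc : IsLipschitzCost X c M G) (hγ : 0 < γ) (hX : IsCompact X) (hα : ∀ᵐ x ∂α, x ∈ X)
    (hβ : ∀ᵐ x ∂β, x ∈ X)
    {x y : E} (hx : x ∈ X) (hy : y ∈ X) : f x + g y ≤ 2 * M := by
  have := softMin_le_softMin_add (w₁ := fun _ => f x - 2 * M) (t := 0) hγ hX hα
    continuousOn_const (P.continuousOn_left.sub (hc.continuousOn_left hy))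
    (fun z hz => by
      have := P.left_sub_le_bound hc hγ hX hβ hx hz
      have := hc.mem_Icc z hz y hy
      simp only [Pi.sub_apply]; linarith)
  rw [softMin_const hγ] at this
  have h1 := P.right_eq y hy
  simp only [softMin, Pi.sub_apply] at this
  linarith

lemma gibbsKernel_exponent_le [IsProbabilityMeasure α] (P : IsSinkhornPair γ X c α β f g)
    (hc : IsLipschitzCost X c M G) (hγ : 0 < γ) (hX : IsCompact X) (hα : ∀ᵐ x ∂α, x ∈ X)
    (hβ : ∀ᵐ x ∂β, x ∈ X)
    {x y : E} (hx : x ∈ X) (hy : y ∈ X) : (f x + g y - c x y) / γ ≤ 2 * M / γ :=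
  div_le_div_of_nonneg_right (by
    linarith [P.left_add_right_le hc hγ hX hα hβ hx hy, hc.mem_Icc x hx y hy]) hγ.le

end IsSinkhornPair

/-- A Lipschitz constant of `f ⊕ g` as a function of the first marginal. -/
noncomputable def sinkhornStabilityConst (γ M G : ℝ) : ℝ :=
  (4 / Real.exp (-(2 * M) / γ) + 1) *
    (γ * (Real.exp (-(-(2 * M)) / γ) * (Real.exp (M / γ) * (1 + 2 * G / γ))))

/-- Lipschitz stability of the Sinkhorn potentials with respect to the first marginal. -/
lemma IsSinkhornPair.abs_add_sub_add_le {q : ℕ} {γ M G : ℝ}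
    {X : Set (EuclideanSpace ℝ (Fin q))}
    {c : EuclideanSpace ℝ (Fin q) → EuclideanSpace ℝ (Fin q) → ℝ}
    {α α' β : Measure (EuclideanSpace ℝ (Fin q))}
    [IsProbabilityMeasure α] [IsProbabilityMeasure α'] [IsProbabilityMeasure β]
    {f g f' g' : EuclideanSpace ℝ (Fin q) → ℝ}
    (P : IsSinkhornPair γ X c α β f g) (P' : IsSinkhornPair γ X c α' β f' g')
    (hc : IsLipschitzCost X c M G) (hG : 0 ≤ G) (hγ : 0 < γ) (hX : IsCompact X)
    (hα : ∀ᵐ x ∂α, x ∈ X) (hα' : ∀ᵐ x ∂α', x ∈ X) (hβ : ∀ᵐ x ∂β, x ∈ X)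
    {x₀ : EuclideanSpace ℝ (Fin q)} (hx₀ : x₀ ∈ X) (hf₀ : f x₀ = 0) (hf₀' : f' x₀ = 0)
    {x y : EuclideanSpace ℝ (Fin q)} (hx : x ∈ X) (hy : y ∈ X) :
    |(f x + g y) - (f' x + g' y)| ≤ sinkhornStabilityConst γ M G * dblOn X α α' := by
  set K := γ * (Real.exp (-(-(2 * M)) / γ) * (Real.exp (M / γ) * (1 + 2 * G / γ))) with hK
  set d := dblOn X α α' with hd
  have hKd : 0 ≤ K * d := by
    have : 0 ≤ 2 * G / γ := div_nonneg (by linarith) hγ.le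
    exact mul_nonneg (by positivity) (dblOn_nonneg _ _ _)
  set g₁ : EuclideanSpace ℝ (Fin q) → ℝ := fun y => softMin γ α' (fun x => f x - c x y) with hg₁
  have hstep : ∀ y ∈ X, |g y - g₁ y| ≤ K * d := by
    intro y hy
    rw [P.right_eq y hy]
    refine abs_softMin_sub_softMin_le (w := fun x => f x - c x y) hγ (by linarith) hX hα hα'
      (P.continuousOn_left.sub (hc.continuousOn_left hy)) (fun x hx => ?_) (fun x hx => ?_)
      (fun x hx x' hx' => ?_)
    · linarith [P.left_sub_le_bound hc hγ hX hβ hx₀ hx, hc.mem_Icc x hx y hy]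
    · linarith [P.left_sub_le_bound hc hγ hX hβ hx hx₀, hc.mem_Icc x hx y hy]
    · have h1 := abs_sub_le_iff.1 (P.abs_left_sub_le hc hγ hX hβ hx hx')
      have h2 := abs_sub_le_iff.1 (hc.lipschitz_left y hy x hx x' hx')
      rw [abs_sub_le_iff]
      constructor <;> linarith
  obtain ⟨a, ha, hamax⟩ := hX.exists_isMaxOn ⟨x, hx⟩ (P.continuousOn_left.sub P'.continuousOn_left)
  obtain ⟨b, hb, hbmin⟩ := hX.exists_isMinOn ⟨x, hx⟩ (P.continuousOn_left.sub P'.continuousOn_left)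
  have hmax : ∀ z ∈ X, f z - f' z ≤ f a - f' a := fun z hz => hamax hz
  have hmin : ∀ z ∈ X, f b - f' b ≤ f z - f' z := fun z hz => hbmin hz
  set D := (f a - f' a) - (f b - f' b) with hD
  have hDosc : ∀ z ∈ X, ∀ z' ∈ X, (f z - f' z) - (f z' - f' z') ≤ D := fun z hz z' hz' => by
    linarith [hmax z hz, hmin z' hz']
  have hD0 : 0 ≤ D := by linarith [hmax b hb]
  set ε := Real.exp (-(2 * M) / γ) with hε
  have hε0 : 0 < ε := Real.exp_pos _
  have hM : 0 ≤ M := (hc.mem_Icc x hx y hy).1.trans (hc.mem_Icc x hx y hy).2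
  have hε1 : ε ≤ 1 := Real.exp_le_one_iff.2 (div_nonpos_of_nonpos_of_nonneg (by linarith) hγ.le)
  have hg₁osc : ∀ y ∈ X, ∀ y' ∈ X, (g₁ y - g' y) - (g₁ y' - g' y') ≤ (1 - ε) * D := by
    intro y hy y' hy'
    rw [P'.right_eq y hy, P'.right_eq y' hy']
    exact softMin_contraction hγ hX hα' P.continuousOn_left P'.continuousOn_left
      (hc.continuousOn_left hy) (hc.continuousOn_left hy') (fun x hx => hc.mem_Icc x hx y hy)
      (fun x hx => hc.mem_Icc x hx y' hy') hDosc
  have hgosc : ∀ y ∈ X, ∀ y' ∈ X, (g y - g' y) - (g y' - g' y') ≤ 2 * (K * d) + (1 - ε) * D := by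
    intro y hy y' hy'
    linarith [hg₁osc y hy y' hy', abs_sub_le_iff.1 (hstep y hy), abs_sub_le_iff.1 (hstep y' hy')]
  have hfosc : D ≤ (1 - ε) * (2 * (K * d) + (1 - ε) * D) := by
    have h := softMin_contraction hγ hX hβ P.continuousOn_right P'.continuousOn_right
      (hc.continuousOn_right ha) (hc.continuousOn_right hb) (fun y hy => hc.mem_Icc a ha y hy)
      (fun y hy => hc.mem_Icc b hb y hy) hgosc
    have ea : f a = softMin γ β (fun y => g y - c a y) := P.left_eq a ha
    have eb : f b = softMin γ β (fun y => g y - c b y) := P.left_eq b hb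
    have ea' : f' a = softMin γ β (fun y => g' y - c a y) := P'.left_eq a ha
    have eb' : f' b = softMin γ β (fun y => g' y - c b y) := P'.left_eq b hb
    rwa [← ea, ← eb, ← ea', ← eb'] at h
  have hDle : D ≤ 2 / ε * (K * d) := by
    rw [div_mul_eq_mul_div, le_div_iff₀ hε0]
    have : 0 ≤ ε * (2 * (K * d) + (1 - ε) * D) :=
      mul_nonneg hε0.le (add_nonneg (by linarith) (mul_nonneg (by linarith) hD0))
    linarith
  have hfx : ∀ x ∈ X, |f x - f' x| ≤ D := fun x hx => by
    have h1 := hDosc x hx x₀ hx₀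
    have h2 := hDosc x₀ hx₀ x hx
    rw [hf₀, hf₀'] at h1 h2
    rw [abs_sub_le_iff]
    constructor <;> linarith
  have hgy : |g₁ y - g' y| ≤ D := by
    have h1 := softMin_le_softMin_add (t := D) hγ hX hα'
      (w₁ := fun x => f x - c x y) (w₂ := fun x => f' x - c x y)
      (P.continuousOn_left.sub (hc.continuousOn_left hy))
      (P'.continuousOn_left.sub (hc.continuousOn_left hy))
      (fun z hz => by linarith [abs_sub_le_iff.1 (hfx z hz)])
    have h2 := softMin_le_softMin_add (t := D) hγ hX hα'
      (w₁ := fun x => f' x - c x y) (w₂ := fun x => f x - c x y)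
      (P'.continuousOn_left.sub (hc.continuousOn_left hy))
      (P.continuousOn_left.sub (hc.continuousOn_left hy))
      (fun z hz => by linarith [abs_sub_le_iff.1 (hfx z hz)])
    have h3 : g' y = softMin γ α' (fun x => f' x - c x y) := P'.right_eq y hy
    rw [h3, abs_sub_le_iff]
    constructor <;> linarith
  have hfinal : sinkhornStabilityConst γ M G * d = 2 * (2 / ε * (K * d)) + K * d := by
    simp only [sinkhornStabilityConst, ← hK, ← hε]; ring
  rw [hfinal, abs_sub_le_iff]
  have h1 := abs_sub_le_iff.1 (hfx x hx)
  have h2 := abs_sub_le_iff.1 (hstep y hy)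
  have h3 := abs_sub_le_iff.1 hgy
  constructor <;> linarith

/-- Lipschitz stability of the Gibbs kernel with respect to the first marginal. -/
lemma IsSinkhornPair.abs_gibbsKernel_sub_le {q : ℕ} {γ M G : ℝ}
    {X : Set (EuclideanSpace ℝ (Fin q))}
    {c : EuclideanSpace ℝ (Fin q) → EuclideanSpace ℝ (Fin q) → ℝ}
    {α α' β : Measure (EuclideanSpace ℝ (Fin q))}
    [IsProbabilityMeasure α] [IsProbabilityMeasure α'] [IsProbabilityMeasure β]
    {f g f' g' : EuclideanSpace ℝ (Fin q) → ℝ}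
    (P : IsSinkhornPair γ X c α β f g) (P' : IsSinkhornPair γ X c α' β f' g')
    (hc : IsLipschitzCost X c M G) (hG : 0 ≤ G) (hγ : 0 < γ) (hX : IsCompact X)
    (hα : ∀ᵐ x ∂α, x ∈ X) (hα' : ∀ᵐ x ∂α', x ∈ X) (hβ : ∀ᵐ x ∂β, x ∈ X)
    {x₀ : EuclideanSpace ℝ (Fin q)} (hx₀ : x₀ ∈ X) (hf₀ : f x₀ = 0) (hf₀' : f' x₀ = 0)
    {x y : EuclideanSpace ℝ (Fin q)} (hx : x ∈ X) (hy : y ∈ X) :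
    |gibbsKernel γ c f g x y - gibbsKernel γ c f' g' x y| ≤
      Real.exp (2 * M / γ) * (sinkhornStabilityConst γ M G / γ) * dblOn X α α' := by
  refine (abs_exp_sub_exp_le (P.gibbsKernel_exponent_le hc hγ hX hα hβ hx hy)
    (P'.gibbsKernel_exponent_le hc hγ hX hα' hβ hx hy)).trans ?_
  rw [mul_assoc]
  refine mul_le_mul_of_nonneg_left ?_ (Real.exp_pos _).le
  rw [← sub_div, abs_div, abs_of_pos hγ, div_mul_eq_mul_div]
  refine div_le_div_of_nonneg_right ?_ hγ.le
  rw [sub_sub_sub_cancel_right]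
  exact P.abs_add_sub_add_le P' hc hG hγ hX hα hα' hβ hx₀ hf₀ hf₀' hx hy

end Sinkhorn

section Derivatives

set_option maxSynthPendingDepth 3

open Filter Topology

variable {E : Type*} [NormedAddCommGroup E] [InnerProductSpace ℝ E]

lemma aestronglyMeasurable_fderiv [FiniteDimensional ℝ E] {S W : Type*} [MeasurableSpace S]
    [NormedAddCommGroup W]
    [NormedSpace ℝ W] {ν : Measure S} {F : E → S → W} {x : E}
    (hF : ∀ᶠ z in 𝓝 x, AEStronglyMeasurable (F z) ν)
    (hd : ∀ y, DifferentiableAt ℝ (fun z => F z y) x) :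
    AEStronglyMeasurable (fun y => fderiv ℝ (fun z => F z y) x) ν := by
  have happ : ∀ v : E, AEStronglyMeasurable (fun y => fderiv ℝ (fun z => F z y) x v) ν := by
    intro v
    have hto : Tendsto (fun n : ℕ => x + ((n : ℝ))⁻¹ • v) atTop (𝓝 x) := by
      have : Tendsto (fun n : ℕ => x + ((n : ℝ))⁻¹ • v) atTop (𝓝 (x + (0 : ℝ) • v)) :=
        tendsto_const_nhds.add (tendsto_inv_atTop_nhds_zero_nat.smul_const v)
      simpa using this
    obtain ⟨N, hN⟩ := eventually_atTop.1 (hto.eventually hF)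
    refine aestronglyMeasurable_of_tendsto_ae atTop
      (f := fun (n : ℕ) y => ((n + N : ℕ) : ℝ) • (F (x + (((n + N : ℕ) : ℝ))⁻¹ • v) y - F x y))
      (fun n => ((hN _ (Nat.le_add_left N n)).sub hF.self_of_nhds).const_smul _)
      (Eventually.of_forall fun y => ?_)
    have hlim := (hd y).hasFDerivAt.lim v (c := fun n : ℕ => (n : ℝ)) (l := atTop)
      (by simpa using tendsto_natCast_atTop_atTop)
    exact hlim.comp (tendsto_add_atTop_nat N)
  have hrepr : (fun y => fderiv ℝ (fun z => F z y) x) = fun y =>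
      ∑ i, ContinuousLinearMap.smulRightL ℝ E W (innerSL ℝ (stdOrthonormalBasis ℝ E i))
        (fderiv ℝ (fun z => F z y) x (stdOrthonormalBasis ℝ E i)) := by
    funext y
    ext v
    conv_lhs => rw [← (stdOrthonormalBasis ℝ E).sum_repr' v]
    simp [map_sum]
  rw [hrepr]
  refine Finset.aestronglyMeasurable_fun_sum _ fun i _ => ?_
  exact (ContinuousLinearMap.continuous _).comp_aestronglyMeasurable (happ _)

/-- Lipschitz costs which are twice differentiable in the first variable, with bounded first and
second derivatives. -/
structure IsSmoothCost (X : Set E) (c : E → E → ℝ) (M G L : ℝ) : Prop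
    extends IsLipschitzCost X c M G where
  contDiff : ∀ y, ContDiff ℝ 2 (fun x => c x y)
  norm_fderiv_le : ∀ y ∈ X, ∀ x ∈ X, ‖fderiv ℝ (fun z => c z y) x‖ ≤ G
  norm_fderiv_fderiv_le : ∀ y ∈ X, ∀ x ∈ interior X,
    ‖fderiv ℝ (fderiv ℝ (fun z => c z y)) x‖ ≤ L

/-- The derivative of `z ↦ gibbsKernel γ c f g z y • fderiv ℝ (c · y) z`. -/
noncomputable def gibbsHessian (γ : ℝ) (c : E → E → ℝ) (f g : E → ℝ) (x y : E) :
    E →L[ℝ] E →L[ℝ] ℝ :=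
  gibbsKernel γ c f g x y • fderiv ℝ (fderiv ℝ (fun z => c z y)) x +
    (gibbsKernel γ c f g x y • γ⁻¹ • (fderiv ℝ f x - fderiv ℝ (fun z => c z y) x)).smulRight
      (fderiv ℝ (fun z => c z y) x)

namespace IsSmoothCost

variable {X : Set E} {c : E → E → ℝ} {M G L : ℝ}

lemma differentiable (hc : IsSmoothCost X c M G L) (y : E) : Differentiable ℝ (fun x => c x y) :=
  (hc.contDiff y).differentiable (by norm_num)

lemma differentiable_fderiv (hc : IsSmoothCost X c M G L) (y : E) :
    Differentiable ℝ (fderiv ℝ (fun x => c x y)) :=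
  ((hc.contDiff y).fderiv_right (m := 1) (by norm_num)).differentiable (by norm_num)

variable [FiniteDimensional ℝ E] [MeasurableSpace E] [BorelSpace E] {β : Measure E}
  [IsProbabilityMeasure β]

lemma aestronglyMeasurable_fderiv (hc : IsSmoothCost X c M G L) (hX : IsCompact X)
    (hβ : ∀ᵐ x ∂β, x ∈ X) {x : E} (hx : x ∈ interior X) :
    AEStronglyMeasurable (fun y => fderiv ℝ (fun z => c z y) x) β :=
  _root_.aestronglyMeasurable_fderiv
    (eventually_of_mem (isOpen_interior.mem_nhds hx) fun _ hz =>
      ((hc.continuousOn_right (interior_subset hz)).integrable_of_isCompact_of_ae_mem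
        hX hβ).aestronglyMeasurable)
    fun y => (hc.differentiable y) x

lemma aestronglyMeasurable_fderiv_fderiv (hc : IsSmoothCost X c M G L) (hX : IsCompact X)
    (hβ : ∀ᵐ x ∂β, x ∈ X) {x : E} (hx : x ∈ interior X) :
    AEStronglyMeasurable (fun y => fderiv ℝ (fderiv ℝ (fun z => c z y)) x) β :=
  _root_.aestronglyMeasurable_fderiv (F := fun z y => fderiv ℝ (fun w => c w y) z)
    (eventually_of_mem (isOpen_interior.mem_nhds hx) fun _ hz =>
      hc.aestronglyMeasurable_fderiv hX hβ hz)
    fun y => (hc.differentiable_fderiv y) x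

end IsSmoothCost

namespace IsSinkhornPair

variable [MeasurableSpace E] [BorelSpace E] {γ M G L : ℝ}
  {X : Set E} {c : E → E → ℝ} {α β : Measure E} {f g : E → ℝ}
  [IsProbabilityMeasure β]

lemma norm_gibbsHessian_le [IsProbabilityMeasure α] (P : IsSinkhornPair γ X c α β f g)
    (hc : IsSmoothCost X c M G L) (hG : 0 ≤ G) (hγ : 0 < γ) (hX : IsCompact X)
    (hα : ∀ᵐ x ∂α, x ∈ X) (hβ : ∀ᵐ x ∂β, x ∈ X)
    {x y : E} (hx : x ∈ interior X) (hy : y ∈ X) :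
    ‖gibbsHessian γ c f g x y‖ ≤ Real.exp (2 * M / γ) * (L + γ⁻¹ * (G + G) * G) := by
  have hxX : x ∈ X := interior_subset hx
  have hk : gibbsKernel γ c f g x y ≤ Real.exp (2 * M / γ) :=
    Real.exp_le_exp.2 (P.gibbsKernel_exponent_le hc.toIsLipschitzCost hγ hX hα hβ hxX hy)
  have hk0 : 0 < gibbsKernel γ c f g x y := Real.exp_pos _
  have hdc := hc.norm_fderiv_le y hy x hxX
  have hdf : ‖fderiv ℝ f x‖ ≤ G := norm_fderiv_le_of_lip' ℝ hG
    (eventually_of_mem (isOpen_interior.mem_nhds hx) fun z hz =>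
      P.abs_left_sub_le hc.toIsLipschitzCost hγ hX hβ (interior_subset hz) hxX)
  have hsub := (norm_sub_le (fderiv ℝ f x) (fderiv ℝ (fun z => c z y) x)).trans
    (add_le_add hdf hdc)
  have hL := hc.norm_fderiv_fderiv_le y hy x hx
  refine (norm_add_le _ _).trans ?_
  rw [ContinuousLinearMap.norm_smulRight_apply, norm_smul, norm_smul, norm_smul,
    Real.norm_eq_abs, abs_of_pos hk0, Real.norm_eq_abs, abs_of_pos (inv_pos.2 hγ), mul_add,
    mul_assoc (gibbsKernel γ c f g x y)]
  gcongr

variable [FiniteDimensional ℝ E]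

lemma hasFDerivAt_left (P : IsSinkhornPair γ X c α β f g) (hc : IsSmoothCost X c M G L)
    (hγ : 0 < γ) (hX : IsCompact X) (hβ : ∀ᵐ x ∂β, x ∈ X) {x : E} (hx : x ∈ interior X) :
    HasFDerivAt f (∫ y, gibbsKernel γ c f g x y • fderiv ℝ (fun z => c z y) x ∂β) x := by
  have hnhds : interior X ∈ 𝓝 x := isOpen_interior.mem_nhds hx
  have hxX : x ∈ X := interior_subset hx
  have hint : ∀ z ∈ interior X, Integrable (fun y => Real.exp ((g y - c z y) / γ)) β := fun z hz =>
    (P.continuousOn_right.sub (hc.continuousOn_right (interior_subset hz))).integrable_exp_div hX hβ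
  have hZ : HasFDerivAt (fun z => ∫ y, Real.exp ((g y - c z y) / γ) ∂β)
      (∫ y, Real.exp ((g y - c x y) / γ) • (-γ⁻¹) • fderiv ℝ (fun z => c z y) x ∂β) x := by
    refine hasFDerivAt_integral_of_dominated_of_fderiv_le
      (F' := fun x y => Real.exp ((g y - c x y) / γ) • (-γ⁻¹) • fderiv ℝ (fun z => c z y) x)
      (bound := fun y => Real.exp (g y / γ) * (γ⁻¹ * G))
      hnhds (eventually_of_mem hnhds fun z hz => (hint z hz).aestronglyMeasurable) (hint x hx)
      ((hint x hx).aestronglyMeasurable.smul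
        ((hc.aestronglyMeasurable_fderiv hX hβ hx).const_smul (-γ⁻¹))) ?_
      ((P.continuousOn_right.integrable_exp_div hX hβ).mul_const _) ?_
    · filter_upwards [hβ] with y hy z hz
      have hzX := interior_subset hz
      rw [norm_smul, norm_smul, norm_neg, Real.norm_eq_abs, abs_of_pos (Real.exp_pos _),
        Real.norm_eq_abs, abs_of_pos (inv_pos.2 hγ)]
      have h1 := hc.norm_fderiv_le y hy z hzX
      have h2 : Real.exp ((g y - c z y) / γ) ≤ Real.exp (g y / γ) :=
        Real.exp_le_exp.2 (div_le_div_of_nonneg_right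
          (by linarith [hc.mem_Icc z hzX y hy]) hγ.le)
      gcongr
    · refine Eventually.of_forall fun y z _ => ?_
      have h1 : HasFDerivAt (fun z => (g y - c z y) / γ)
          (-γ⁻¹ • fderiv ℝ (fun z => c z y) z) z := by
        rw [neg_smul, ← smul_neg]
        simp only [div_eq_mul_inv]
        exact ((hc.differentiable y z).hasFDerivAt.const_sub (g y)).mul_const γ⁻¹
      exact h1.exp
  have hpos : 0 < ∫ y, Real.exp ((g y - c x y) / γ) ∂β := integral_exp_pos (hint x hx)
  have hlog := (hZ.log hpos.ne').const_mul (-γ)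
  have heq : f =ᶠ[𝓝 x] fun z => -γ * Real.log (∫ y, Real.exp ((g y - c z y) / γ) ∂β) :=
    eventually_of_mem hnhds fun z hz => P.left_eq z (interior_subset hz)
  refine (hlog.congr_of_eventuallyEq heq).congr_fderiv ?_
  have hexp := exp_neg_softMin_div (μ := β) hγ
    (P.continuousOn_right.sub (hc.continuousOn_right hxX)) hX hβ
  have hfx : f x = softMin γ β (g - fun y => c x y) := P.left_eq x hxX
  rw [← hfx] at hexp
  simp only [Pi.sub_apply] at hexp
  rw [← hexp, ← Real.exp_neg, ← integral_smul, ← integral_smul]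
  refine integral_congr_ae (Eventually.of_forall fun y => ?_)
  simp only [smul_smul, gibbsKernel]
  congr 1
  have : Real.exp ((f x + g y - c x y) / γ) =
      Real.exp (-(-f x / γ)) * Real.exp ((g y - c x y) / γ) := by
    rw [← Real.exp_add]; congr 1; ring
  rw [this]
  field_simp

lemma aestronglyMeasurable_gibbsHessian (P : IsSinkhornPair γ X c α β f g)
    (hc : IsSmoothCost X c M G L) (hX : IsCompact X) (hβ : ∀ᵐ x ∂β, x ∈ X)
    {x : E} (hx : x ∈ interior X) : AEStronglyMeasurable (gibbsHessian γ c f g x) β := by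
  have hk := ((P.continuousOn_gibbsKernel hc.toIsLipschitzCost
    (interior_subset hx)).integrable_of_isCompact_of_ae_mem hX hβ).aestronglyMeasurable
  have h1 := hc.aestronglyMeasurable_fderiv hX hβ hx
  have h2 := hc.aestronglyMeasurable_fderiv_fderiv hX hβ hx
  refine (hk.smul h2).add ?_
  have hcont : Continuous fun p : (E →L[ℝ] ℝ) × (E →L[ℝ] ℝ) => p.1.smulRight p.2 :=
    (ContinuousLinearMap.smulRightL ℝ E (E →L[ℝ] ℝ)).isBoundedBilinearMap.continuous
  exact hcont.comp_aestronglyMeasurable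
    ((hk.smul ((aestronglyMeasurable_const.sub h1).const_smul γ⁻¹)).prodMk h1)

lemma integrable_gibbsHessian [IsProbabilityMeasure α] (P : IsSinkhornPair γ X c α β f g)
    (hc : IsSmoothCost X c M G L) (hG : 0 ≤ G) (hγ : 0 < γ) (hX : IsCompact X)
    (hα : ∀ᵐ x ∂α, x ∈ X) (hβ : ∀ᵐ x ∂β, x ∈ X)
    {x : E} (hx : x ∈ interior X) : Integrable (gibbsHessian γ c f g x) β :=
  Integrable.of_bound (P.aestronglyMeasurable_gibbsHessian hc hX hβ hx) _
    (hβ.mono fun _ hy => P.norm_gibbsHessian_le hc hG hγ hX hα hβ hx hy)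

lemma integrable_gibbsKernel_smul_fderiv [IsProbabilityMeasure α] (P : IsSinkhornPair γ X c α β f g)
    (hc : IsSmoothCost X c M G L)
    (hγ : 0 < γ) (hX : IsCompact X) (hα : ∀ᵐ x ∂α, x ∈ X) (hβ : ∀ᵐ x ∂β, x ∈ X)
    {x : E} (hx : x ∈ interior X) :
    Integrable (fun y => gibbsKernel γ c f g x y • fderiv ℝ (fun z => c z y) x) β := by
  have hxX : x ∈ X := interior_subset hx
  have hk := ((P.continuousOn_gibbsKernel hc.toIsLipschitzCost
    hxX).integrable_of_isCompact_of_ae_mem hX hβ).aestronglyMeasurable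
  refine Integrable.of_bound (hk.smul (hc.aestronglyMeasurable_fderiv hX hβ hx))
    (Real.exp (2 * M / γ) * G) (hβ.mono fun y hy => ?_)
  rw [norm_smul, Real.norm_eq_abs, gibbsKernel, abs_of_pos (Real.exp_pos _)]
  have h1 := P.gibbsKernel_exponent_le hc.toIsLipschitzCost hγ hX hα hβ hxX hy
  have h2 := hc.norm_fderiv_le y hy x hxX
  gcongr

lemma hasFDerivAt_fderiv_left [IsProbabilityMeasure α] (P : IsSinkhornPair γ X c α β f g)
    (hc : IsSmoothCost X c M G L) (hG : 0 ≤ G) (hγ : 0 < γ) (hX : IsCompact X)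
    (hα : ∀ᵐ x ∂α, x ∈ X) (hβ : ∀ᵐ x ∂β, x ∈ X)
    {x : E} (hx : x ∈ interior X) :
    HasFDerivAt (fderiv ℝ f) (∫ y, gibbsHessian γ c f g x y ∂β) x := by
  have hnhds : interior X ∈ 𝓝 x := isOpen_interior.mem_nhds hx
  have hint := fun z hz => P.integrable_gibbsKernel_smul_fderiv hc hγ hX hα hβ (x := z) hz
  have hI : HasFDerivAt (fun z => ∫ y, gibbsKernel γ c f g z y • fderiv ℝ (fun w => c w y) z ∂β)
      (∫ y, gibbsHessian γ c f g x y ∂β) x := by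
    refine hasFDerivAt_integral_of_dominated_of_fderiv_le (F' := gibbsHessian γ c f g)
      hnhds (eventually_of_mem hnhds fun z hz => (hint z hz).aestronglyMeasurable) (hint x hx)
      (P.aestronglyMeasurable_gibbsHessian hc hX hβ hx)
      (hβ.mono fun y hy z hz => P.norm_gibbsHessian_le hc hG hγ hX hα hβ hz hy)
      (integrable_const _) (Eventually.of_forall fun y z hz => ?_)
    have hf : HasFDerivAt f (fderiv ℝ f z) z :=
      (P.hasFDerivAt_left hc hγ hX hβ hz).differentiableAt.hasFDerivAt
    have hk : HasFDerivAt (fun z => gibbsKernel γ c f g z y) (gibbsKernel γ c f g z y •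
        γ⁻¹ • (fderiv ℝ f z - fderiv ℝ (fun w => c w y) z)) z := by
      have h1 : HasFDerivAt (fun z => (f z + g y - c z y) / γ)
          (γ⁻¹ • (fderiv ℝ f z - fderiv ℝ (fun w => c w y) z)) z := by
        simp only [div_eq_mul_inv]
        exact ((hf.add_const (g y)).sub (hc.differentiable y z).hasFDerivAt).mul_const γ⁻¹
      exact h1.exp
    exact hk.fun_smul (hc.differentiable_fderiv y z).hasFDerivAt
  exact hI.congr_of_eventuallyEq
    (eventually_of_mem hnhds fun z hz => (P.hasFDerivAt_left hc hγ hX hβ hz).fderiv)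

end IsSinkhornPair

/-- The real-linear form of the inverse Riesz isomorphism. -/
noncomputable def rieszVector (E : Type*) [NormedAddCommGroup E] [InnerProductSpace ℝ E]
    [CompleteSpace E] : (E →L[ℝ] ℝ) →L[ℝ] E :=
  LinearMap.mkContinuous
    { toFun := fun φ => (InnerProductSpace.toDual ℝ E).symm φ
      map_add' := fun φ ψ => map_add _ φ ψ
      map_smul' := fun r φ => by simp } 1
    fun φ => by simp

lemma norm_rieszVector_le [CompleteSpace E] : ‖rieszVector E‖ ≤ 1 :=
  LinearMap.mkContinuous_norm_le _ zero_le_one _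

lemma fderiv_gradient [CompleteSpace E] {f : E → ℝ} {x : E} {A : E →L[ℝ] E →L[ℝ] ℝ}
    (hf : HasFDerivAt (fderiv ℝ f) A x) :
    fderiv ℝ (gradient f) x = (rieszVector E).comp A :=
  ((rieszVector E).hasFDerivAt.comp x hf).fderiv

lemma norm_gradient_eq [CompleteSpace E] (f : E → ℝ) (x : E) : ‖gradient f x‖ = ‖fderiv ℝ f x‖ :=
  LinearIsometryEquiv.norm_map _ _

lemma norm_gradient_sub_eq [CompleteSpace E] (f : E → ℝ) (x x' : E) :
    ‖gradient f x - gradient f x'‖ = ‖fderiv ℝ f x - fderiv ℝ f x'‖ := by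
  rw [gradient, gradient, ← map_sub, LinearIsometryEquiv.norm_map]


/-- The Hessian integrals of two Sinkhorn potentials differ by at most a multiple of the
difference of their Gibbs kernels. -/
lemma IsSinkhornPair.norm_integral_gibbsHessian_sub_le {q : ℕ} {γ M G L : ℝ}
    {X : Set (EuclideanSpace ℝ (Fin q))}
    {c : EuclideanSpace ℝ (Fin q) → EuclideanSpace ℝ (Fin q) → ℝ}
    {α α' β : Measure (EuclideanSpace ℝ (Fin q))}
    [IsProbabilityMeasure α] [IsProbabilityMeasure α'] [IsProbabilityMeasure β]
    {f g f' g' : EuclideanSpace ℝ (Fin q) → ℝ}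
    (P : IsSinkhornPair γ X c α β f g) (P' : IsSinkhornPair γ X c α' β f' g')
    (hc : IsSmoothCost X c M G L) (hG : 0 ≤ G) (hγ : 0 < γ) (hX : IsCompact X)
    (hα : ∀ᵐ x ∂α, x ∈ X) (hα' : ∀ᵐ x ∂α', x ∈ X) (hβ : ∀ᵐ x ∂β, x ∈ X)
    {δ : ℝ} {x : EuclideanSpace ℝ (Fin q)} (hx : x ∈ interior X)
    (hδ : ∀ y ∈ X, |gibbsKernel γ c f g x y - gibbsKernel γ c f' g' x y| ≤ δ) :
    ‖(∫ y, gibbsHessian γ c f g x y ∂β) - ∫ y, gibbsHessian γ c f' g' x y ∂β‖ ≤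
      δ * L + (δ * (γ⁻¹ * (G + G)) + Real.exp (2 * M / γ) * (γ⁻¹ * (δ * G))) * G := by
  have hxX : x ∈ X := interior_subset hx
  have hδ0 : 0 ≤ δ := (abs_nonneg _).trans (hδ x hxX)
  have hdf : ‖fderiv ℝ f x‖ ≤ G := norm_fderiv_le_of_lip' ℝ hG
    (eventually_of_mem (isOpen_interior.mem_nhds hx) fun z hz =>
      P.abs_left_sub_le hc.toIsLipschitzCost hγ hX hβ (interior_subset hz) hxX)
  have hdfsub : ‖fderiv ℝ f x - fderiv ℝ f' x‖ ≤ δ * G := by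
    rw [(P.hasFDerivAt_left hc hγ hX hβ hx).fderiv, (P'.hasFDerivAt_left hc hγ hX hβ hx).fderiv,
      ← integral_sub (P.integrable_gibbsKernel_smul_fderiv hc hγ hX hα hβ hx)
        (P'.integrable_gibbsKernel_smul_fderiv hc hγ hX hα' hβ hx)]
    refine (norm_integral_le_of_norm_le_const (C := δ * G) (hβ.mono fun y hy => ?_)).trans
      (by simp)
    rw [← sub_smul, norm_smul]
    exact mul_le_mul (hδ y hy) (hc.norm_fderiv_le y hy x hxX) (norm_nonneg _) hδ0
  rw [← integral_sub (P.integrable_gibbsHessian hc hG hγ hX hα hβ hx)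
    (P'.integrable_gibbsHessian hc hG hγ hX hα' hβ hx)]
  refine (norm_integral_le_of_norm_le_const
    (C := δ * L + (δ * (γ⁻¹ * (G + G)) + Real.exp (2 * M / γ) * (γ⁻¹ * (δ * G))) * G)
    (hβ.mono fun y hy => ?_)).trans (by simp)
  have hdc := hc.norm_fderiv_le y hy x hxX
  have hL := hc.norm_fderiv_fderiv_le y hy x hx
  have hk' : |gibbsKernel γ c f' g' x y| ≤ Real.exp (2 * M / γ) := by
    rw [gibbsKernel, abs_of_pos (Real.exp_pos _)]
    exact Real.exp_le_exp.2 (P'.gibbsKernel_exponent_le hc.toIsLipschitzCost hγ hX hα' hβ hxX hy)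
  have hh := hδ y hy
  have hsub := (norm_sub_le (fderiv ℝ f x) (fderiv ℝ (fun z => c z y) x)).trans
    (add_le_add hdf hdc)
  have hdecomp : gibbsHessian γ c f g x y - gibbsHessian γ c f' g' x y =
      (gibbsKernel γ c f g x y - gibbsKernel γ c f' g' x y) •
        fderiv ℝ (fderiv ℝ (fun z => c z y)) x +
      ((gibbsKernel γ c f g x y - gibbsKernel γ c f' g' x y) •
          γ⁻¹ • (fderiv ℝ f x - fderiv ℝ (fun z => c z y) x) +
        gibbsKernel γ c f' g' x y • γ⁻¹ • (fderiv ℝ f x - fderiv ℝ f' x)).smulRight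
          (fderiv ℝ (fun z => c z y) x) := by
    ext v w
    simp only [gibbsHessian, add_apply, sub_apply,
      smul_apply, ContinuousLinearMap.smulRight_apply, smul_eq_mul]
    ring
  rw [hdecomp]
  refine (norm_add_le _ _).trans ?_
  rw [ContinuousLinearMap.norm_smulRight_apply, norm_smul, Real.norm_eq_abs]
  refine add_le_add (mul_le_mul hh hL (norm_nonneg _) hδ0)
    (mul_le_mul ((norm_add_le _ _).trans ?_) hdc (norm_nonneg _) (by positivity))
  rw [norm_smul, norm_smul, norm_smul, norm_smul, Real.norm_eq_abs, Real.norm_eq_abs,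
    Real.norm_eq_abs, abs_of_pos (inv_pos.2 hγ)]
  gcongr

end Derivatives

/-- **Lipschitz stability of the Hessian of the Sinkhorn potential w.r.t. the
first marginal.** There is a constant `C`, depending only on `M_c`, `G_c`, `L_c`,
`L_{2,c}` and `γ`, such that for all marginals and all normalized Sinkhorn
potential pairs `(f, g)` for `(α, β)` and `(f', g')` for `(α', β)` one has
`sup_x ‖∇²f(x) - ∇²f'(x)‖_op ≤ C · d_bl(α, α')`. -/
theorem sinkhorn_potential_hessian_stability
    {q : ℕ} (γ Mc Gc Lc L2c : ℝ) (hγ : 0 < γ) :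
    ∃ C : ℝ,
    ∀ (X : Set (EuclideanSpace ℝ (Fin q))), IsCompact X →
    ∀ (c : EuclideanSpace ℝ (Fin q) → EuclideanSpace ℝ (Fin q) → ℝ),
    ContinuousOn (fun p : EuclideanSpace ℝ (Fin q) × EuclideanSpace ℝ (Fin q) =>
      c p.1 p.2) (X ×ˢ X) →
    (∀ x ∈ X, ∀ y ∈ X, 0 ≤ c x y ∧ c x y ≤ Mc) →
    (∀ y ∈ X, ∀ x ∈ X, ∀ x' ∈ X, |c x y - c x' y| ≤ Gc * ‖x - x'‖) →
    (∀ x ∈ X, ∀ y ∈ X, ∀ y' ∈ X, |c x y - c x y'| ≤ Gc * ‖y - y'‖) →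
    (∀ y, ContDiff ℝ 2 (fun x => c x y)) →
    (∀ y ∈ X, ∀ x ∈ X, ‖gradient (fun x' => c x' y) x‖ ≤ Gc) →
    (∀ y ∈ X, ∀ x ∈ X, ∀ x' ∈ X,
      ‖gradient (fun x'' => c x'' y) x - gradient (fun x'' => c x'' y) x'‖ ≤ Lc * ‖x - x'‖) →
    (∀ y ∈ X, ∀ x ∈ X, ∀ x' ∈ X,
      ‖fderiv ℝ (gradient (fun x'' => c x'' y)) x -
        fderiv ℝ (gradient (fun x'' => c x'' y)) x'‖ ≤ L2c * ‖x - x'‖) →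
    ∀ (α α' β : Measure (EuclideanSpace ℝ (Fin q))),
    IsProbabilityMeasure α → IsProbabilityMeasure α' → IsProbabilityMeasure β →
    α Xᶜ = 0 → α' Xᶜ = 0 → β Xᶜ = 0 →
    ∀ (f g f' g' : EuclideanSpace ℝ (Fin q) → ℝ),
    ContinuousOn f X → ContinuousOn g X → ContinuousOn f' X → ContinuousOn g' X →
    (∀ y ∈ X, g y = -γ * Real.log (∫ x, Real.exp ((f x - c x y) / γ) ∂α)) →
    (∀ x ∈ X, f x = -γ * Real.log (∫ y, Real.exp ((g y - c x y) / γ) ∂β)) →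
    (∀ y ∈ X, g' y = -γ * Real.log (∫ x, Real.exp ((f' x - c x y) / γ) ∂α')) →
    (∀ x ∈ X, f' x = -γ * Real.log (∫ y, Real.exp ((g' y - c x y) / γ) ∂β)) →
    ∀ x₀ ∈ X, f x₀ = 0 → f' x₀ = 0 →
    ∀ x ∈ interior X,
      ‖fderiv ℝ (gradient f) x - fderiv ℝ (gradient f') x‖ ≤ C * dblOn X α α' := by
  refine ⟨Real.exp (2 * Mc / γ) * (sinkhornStabilityConst γ Mc Gc / γ) *
    (|Lc| + (γ⁻¹ * (Gc + Gc) + Real.exp (2 * Mc / γ) * (γ⁻¹ * Gc)) * Gc), ?_⟩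
  intro X hX c hcont hbd hlip _ hcd hgrad hgradLip _ α α' β _ _ _ hα hα' hβ f g f' g'
    hf hg hf' hg' hg_eq hf_eq hg_eq' hf_eq' x₀ hx₀ hf₀ hf₀' x hx
  have hG : 0 ≤ Gc := (norm_nonneg _).trans (hgrad x₀ hx₀ x₀ hx₀)
  have hc : IsSmoothCost X c Mc Gc |Lc| :=
    { continuousOn := hcont
      mem_Icc := hbd
      lipschitz_left := hlip
      contDiff := hcd
      norm_fderiv_le := fun y hy z hz => norm_gradient_eq (fun w => c w y) z ▸ hgrad y hy z hz
      norm_fderiv_fderiv_le := fun y hy z hz =>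
        norm_fderiv_le_of_lip' ℝ (abs_nonneg Lc)
          (Filter.eventually_of_mem (isOpen_interior.mem_nhds hz) fun w hw => by
            rw [← norm_gradient_sub_eq]
            exact (hgradLip y hy w (interior_subset hw) z (interior_subset hz)).trans
              (mul_le_mul_of_nonneg_right (le_abs_self Lc) (norm_nonneg _))) }
  have P : IsSinkhornPair γ X c α β f g := ⟨hf, hg, hg_eq, hf_eq⟩
  have P' : IsSinkhornPair γ X c α' β f' g' := ⟨hf', hg', hg_eq', hf_eq'⟩
  have hα : ∀ᵐ x ∂α, x ∈ X := hα
  have hα' : ∀ᵐ x ∂α', x ∈ X := hα'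
  have hβ : ∀ᵐ x ∂β, x ∈ X := hβ
  rw [fderiv_gradient (P.hasFDerivAt_fderiv_left hc hG hγ hX hα hβ hx),
    fderiv_gradient (P'.hasFDerivAt_fderiv_left hc hG hγ hX hα' hβ hx),
    ← ContinuousLinearMap.comp_sub]
  refine (ContinuousLinearMap.opNorm_comp_le _ _).trans
    ((mul_le_of_le_one_left (norm_nonneg _) norm_rieszVector_le).trans
      ((P.norm_integral_gibbsHessian_sub_le P' hc hG hγ hX hα hα' hβ hx fun y hy =>
        P.abs_gibbsKernel_sub_le P' hc.toIsLipschitzCost hG hγ hX hα hα' hβ hx₀ hf₀ hf₀'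
          (interior_subset hx) hy).trans (le_of_eq ?_)))
  ring
end
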